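/- Let X be a finitely generated non-special involutive commutative two-valued group that does not contain a single-valued direct factor and consists entirely of elements of orders 1, 2 and 4. Then X is isomorphic either to X^a_{C_4^n} = C_4^n/ι_a or to X^u_n = (C_2^n×C_2^n)/ι_u for some n ≥ 0. Each of the two-valued groups X^a_{C_4^n} and X^u_n consists of 2^{2n−1} + 2^{n−1} elements; for n ≤ 2 these two two-valued groups are isomorphic, while for n ≥ 3 they are not isomorphic. -/

import Mathlib

/-!
Two-valued groups after V.M. Buchstaber, A.P. Veselov and A.A. Gaifullin.

`X.mul x y` is the two-element multiset `x * y`.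
-/

universe u v w u' v' w'

/-- A two-valued group: a set with a multiplication valued in two-element multisets,
a strong identity `e`, and a (unique) inverse. -/
structure TwoValuedGroup (T : Type u) where
  mul : T → T → Multiset T
  e : T
  inv : T → T
  card_mul : ∀ x y, Multiset.card (mul x y) = 2
  assoc : ∀ x y z, (mul x y).bind (fun t => mul t z) = (mul y z).bind (fun t => mul x t)
  e_mul : ∀ x, mul e x = {x, x}
  mul_e : ∀ x, mul x e = {x, x}
  e_mem_mul_inv : ∀ x, e ∈ mul x (inv x)
  e_mem_inv_mul : ∀ x, e ∈ mul (inv x) x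
  inv_unique : ∀ x y, (e ∈ mul x y ∨ e ∈ mul y x) → y = inv x

namespace TwoValuedGroup

/-- Commutativity of a two-valued group. -/
def Commutative {T : Type u} (X : TwoValuedGroup T) : Prop := ∀ x y, X.mul x y = X.mul y x

/-- Involutivity: every element is its own inverse. -/
def Involutive {T : Type u} (X : TwoValuedGroup T) : Prop := ∀ x, X.inv x = x

/-- A homomorphism of two-valued groups. -/
def IsHom {T : Type u} {S : Type v} (X : TwoValuedGroup T) (Z : TwoValuedGroup S)
    (f : T → S) : Prop :=
  f X.e = Z.e ∧ ∀ x y, (X.mul x y).map f = Z.mul (f x) (f y)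

/-- Two two-valued groups are isomorphic if there is a bijective homomorphism. -/
def Isomorphic {T : Type u} {S : Type v} (X : TwoValuedGroup T) (Z : TwoValuedGroup S) : Prop :=
  ∃ f : T → S, Function.Bijective f ∧ IsHom X Z f

/-- A subgroup of a two-valued group: a subset closed under multiplication. -/
def IsSubgroup {T : Type u} (X : TwoValuedGroup T) (Y : Set T) : Prop :=
  ∀ y₁ ∈ Y, ∀ y₂ ∈ Y, ∀ z ∈ X.mul y₁ y₂, z ∈ Y

/-- `S` generates `X` if the only subgroup of `X` containing `S` is all of `X`. -/
def Generates {T : Type u} (X : TwoValuedGroup T) (S : Set T) : Prop :=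
  ∀ Y : Set T, X.IsSubgroup Y → S ⊆ Y → Y = Set.univ

/-- Finitely generated two-valued group. -/
def FinitelyGenerated {T : Type u} (X : TwoValuedGroup T) : Prop :=
  ∃ S : Set T, S.Finite ∧ X.Generates S

/-- A family of integer power sequences: `P x k` is the `k`-th power `x^k` of `x`;
these are uniquely determined in an involutive two-valued group. -/
def IsPowFamily {T : Type u} (X : TwoValuedGroup T) (P : T → ℤ → T) : Prop :=
  ∀ x : T, P x 0 = X.e ∧ P x 1 = x ∧ (∀ k : ℤ, P x (-k) = P x k) ∧
    ∀ k : ℤ, 1 ≤ k → X.mul x (P x k) = {P x (k - 1), P x (k + 1)}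

/-- The order of an element: the least positive `k` with `x^k = e`;
the value `0` encodes infinite order. -/
noncomputable def ordOf {T : Type u} (X : TwoValuedGroup T) (P : T → ℤ → T) (x : T) : ℕ :=
  sInf {n : ℕ | 0 < n ∧ P x (n : ℤ) = X.e}

/-- `ord x > 2` (where infinite order counts as `> 2`). -/
def OrdGT2 {T : Type u} (X : TwoValuedGroup T) (P : T → ℤ → T) (x : T) : Prop :=
  X.ordOf P x = 0 ∨ 2 < X.ordOf P x

/-- A two-valued group is special if it contains a special pair: `ord x > 2`, `ord y > 2`,
and `x * y` consists of two equal elements. -/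
def IsSpecial {T : Type u} (X : TwoValuedGroup T) (P : T → ℤ → T) : Prop :=
  ∃ x y z : T, X.OrdGT2 P x ∧ X.OrdGT2 P y ∧ X.mul x y = {z, z}

/-- `ι` is an involutive automorphism of the group `G`. -/
def IsInvolutiveAut (G : Type v) [Group G] (ι : G → G) : Prop :=
  Function.Bijective ι ∧ (∀ g h : G, ι (g * h) = ι g * ι h) ∧ (∀ g : G, ι (ι g) = g)

/-- `X` is isomorphic to the coset two-valued group `G/ι`: there is a quotient map
`π : G → X` whose fibres are exactly the `ι`-orbits and which carries the coset
two-valued multiplication `π g * π h = [π (g h), π (g ι(h))]`. -/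
def IsCosetOf {T : Type u} {G : Type v} [Group G] (X : TwoValuedGroup T) (ι : G → G) : Prop :=
  ∃ π : G → T, Function.Surjective π ∧ π 1 = X.e ∧
    (∀ g, π (ι g) = π g) ∧
    (∀ g h, π g = π h → h = g ∨ h = ι g) ∧
    (∀ g h, X.mul (π g) (π h) = {π (g * h), π (g * ι h)}) ∧
    (∀ g, X.inv (π g) = π g⁻¹)

/-- `X` is isomorphic to the coset two-valued group `X^a_A = A/ι_a`
for the antipodal involution `ι_a (a) = a⁻¹` of the abelian group `A`. -/
def IsAntipodalCosetOf {T : Type u} (X : TwoValuedGroup T) (A : Type v) [CommGroup A] : Prop :=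
  ∃ π : A → T, Function.Surjective π ∧ π 1 = X.e ∧
    (∀ a, π a⁻¹ = π a) ∧
    (∀ a b, π a = π b → b = a ∨ b = a⁻¹) ∧
    (∀ a b, X.mul (π a) (π b) = {π (a * b), π (a * b⁻¹)}) ∧
    (∀ a, X.inv (π a) = π a⁻¹)

/-- A Boolean group: every element squares to the identity. -/
def IsBooleanGroup (V : Type v) [CommGroup V] : Prop := ∀ x : V, x * x = 1

/-- For a Boolean group, `dim V ≥ 2` (as an `𝔽₂`-vector space) is equivalent to the
existence of two distinct nontrivial elements. -/
def BoolDimGE2 (V : Type v) [CommGroup V] : Prop := ∃ a b : V, a ≠ 1 ∧ b ≠ 1 ∧ a ≠ b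

/-- For a Boolean group, `dim V ≥ 3` is equivalent to the existence of three
linearly independent elements. -/
def BoolDimGE3 (V : Type v) [CommGroup V] : Prop :=
  ∃ a b c : V, a ≠ 1 ∧ b ≠ 1 ∧ a ≠ b ∧ c ≠ 1 ∧ c ≠ a ∧ c ≠ b ∧ c ≠ a * b

/-- Isomorphism of (single-valued) groups. -/
def GroupIsomorphic (A : Type v) (B : Type w) [CommGroup A] [CommGroup B] : Prop :=
  Nonempty (A ≃* B)

/-- `X` is isomorphic to the coset two-valued group `X^u_V = (V × V)/ι_u`,
where `ι_u (a, b) = (a, a b)` is the unipotent involution of the Boolean group `V × V`. -/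
def IsUnipotentCosetOf {T : Type u} (X : TwoValuedGroup T) (V : Type v) [CommGroup V] : Prop :=
  ∃ π : V × V → T, Function.Surjective π ∧ π (1, 1) = X.e ∧
    (∀ a b : V, π (a, a * b) = π (a, b)) ∧
    (∀ p q : V × V, π p = π q → q = p ∨ q = (p.1, p.1 * p.2)) ∧
    (∀ a₁ b₁ a₂ b₂ : V,
      X.mul (π (a₁, b₁)) (π (a₂, b₂)) = {π (a₁ * a₂, b₁ * b₂), π (a₁ * a₂, a₂ * b₁ * b₂)}) ∧
    (∀ p : V × V, X.inv (π p) = π p)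

/-- `X` is isomorphic to the direct product `X^u_V × W` of the unipotent coset
two-valued group `X^u_V = (V × V)/ι_u` and the Boolean group `W`. -/
def IsUnipotentCosetProdOf {T : Type u} (X : TwoValuedGroup T) (V : Type v) (W : Type w)
    [CommGroup V] [CommGroup W] : Prop :=
  ∃ f : (V × V) × W → T, Function.Surjective f ∧ f ((1, 1), 1) = X.e ∧
    (∀ (a b : V) (w : W), f ((a, a * b), w) = f ((a, b), w)) ∧
    (∀ p q : (V × V) × W, f p = f q → q.2 = p.2 ∧ (q.1 = p.1 ∨ q.1 = (p.1.1, p.1.1 * p.1.2))) ∧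
    (∀ (a₁ b₁ a₂ b₂ : V) (w₁ w₂ : W),
      X.mul (f ((a₁, b₁), w₁)) (f ((a₂, b₂), w₂)) =
        {f ((a₁ * a₂, b₁ * b₂), w₁ * w₂), f ((a₁ * a₂, a₂ * b₁ * b₂), w₁ * w₂)}) ∧
    (∀ p, X.inv (f p) = f p)

open Classical in
/-- The multiplication table of the special two-valued group `Y_V` on `Option V`:
`none` is the extra element `s`, `some v` are the elements of the Boolean group `V`. -/
noncomputable def mulY {V : Type v} [CommGroup V] : Option V → Option V → Multiset (Option V)
  | some x, some y =>
      if x = y then (if x = 1 then {some 1, some 1} else {some 1, none})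
      else {some (x * y), some (x * y)}
  | some x, none => if x = 1 then {none, none} else {some x, some x}
  | none, some y => if y = 1 then {none, none} else {some y, some y}
  | none, none => {some 1, some 1}

/-- `X` is isomorphic to the special two-valued group `Y_V`. -/
def IsYOf {T : Type u} (X : TwoValuedGroup T) (V : Type v) [CommGroup V] : Prop :=
  ∃ f : Option V → T, Function.Bijective f ∧ f (some 1) = X.e ∧
    (∀ uu vv : Option V, X.mul (f uu) (f vv) = (mulY uu vv).map f) ∧
    (∀ uu : Option V, X.inv (f uu) = f uu)

/-- `X` is isomorphic to the direct product `Y_V × W`. -/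
def IsYProdOf {T : Type u} (X : TwoValuedGroup T) (V : Type v) (W : Type w)
    [CommGroup V] [CommGroup W] : Prop :=
  ∃ f : Option V × W → T, Function.Bijective f ∧ f (some 1, 1) = X.e ∧
    (∀ (uu vv : Option V) (w₁ w₂ : W),
      X.mul (f (uu, w₁)) (f (vv, w₂)) = (mulY uu vv).map (fun z => f (z, w₁ * w₂))) ∧
    (∀ p : Option V × W, X.inv (f p) = f p)

/-- `X` is isomorphic to the direct product `X' × W` of the two-valued group `X'`
and the (single-valued) Boolean group `W`. -/
def IsDirectProdOf {T : Type u} {T' : Type v} (W : Type w) [CommGroup W]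
    (X : TwoValuedGroup T) (X' : TwoValuedGroup T') : Prop :=
  ∃ f : T' × W → T, Function.Bijective f ∧ f (X'.e, 1) = X.e ∧
    (∀ (x₁ x₂ : T') (w₁ w₂ : W),
      X.mul (f (x₁, w₁)) (f (x₂, w₂)) = (X'.mul x₁ x₂).map (fun z => f (z, w₁ * w₂))) ∧
    (∀ (x : T') (w : W), X.inv (f (x, w)) = f (X'.inv x, w))

/-- `X` contains a single-valued direct factor: `X ≅ X' × W` with `W` a nontrivial
Boolean group. -/
def HasSingleValuedDirectFactor {T : Type u} (X : TwoValuedGroup T) : Prop :=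
  ∃ (T' : Type u) (X' : TwoValuedGroup T') (W : Type u) (iW : CommGroup W),
    X'.Commutative ∧ X'.Involutive ∧ @IsBooleanGroup W iW ∧ Nontrivial W ∧
    @IsDirectProdOf T T' W iW X X'

/-- The Boolean group `C₂ⁿ`. -/
abbrev C2vec (n : ℕ) : Type := Fin n → Multiplicative (ZMod 2)

/-- The group `C₄ⁿ`. -/
abbrev C4vec (n : ℕ) : Type := Fin n → Multiplicative (ZMod 4)

end TwoValuedGroup


section Cocycle

variable {V : Type*} [AddCommGroup V]

/-- The modification of `c` by the coboundary of `g`. -/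
def twist (c : V → V → V) (g : V → V) (a b : V) : V := c a b + (g a + g b + g (a + b))

theorem twist_twist (c : V → V → V) (g h : V → V) : twist (twist c g) h = twist c (g + h) := by
  funext a b
  simp only [twist, Pi.add_apply]
  abel

variable [Module (ZMod 2) V]

/-- A symmetric `V`-valued 2-cocycle on `V` in the weak sense: every identity holds modulo the
span of the arguments involved. -/
structure IsWeakCocycle (c : V → V → V) : Prop where
  symm : ∀ (M : Submodule (ZMod 2) V) (a b : V), a ∈ M → b ∈ M → c a b + c b a ∈ M
  self : ∀ (M : Submodule (ZMod 2) V) (a : V), a ∈ M → c a a ∈ M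
  zero : ∀ (M : Submodule (ZMod 2) V) (a : V), a ∈ M → c 0 a ∈ M
  coc : ∀ (M : Submodule (ZMod 2) V) (a b d : V), a ∈ M → b ∈ M → d ∈ M →
    c a b + c (a + b) d + (c b d + c a (b + d)) ∈ M

/-- `c` vanishes on `S` modulo the span of its arguments. -/
def VanishesOn (c : V → V → V) (S : Set V) : Prop :=
  ∀ a ∈ S, ∀ b ∈ S, ∀ M : Submodule (ZMod 2) V, a ∈ M → b ∈ M → c a b ∈ M

theorem mem_of_add_mem_of_mem {M : Submodule (ZMod 2) V} {x y : V} (h : x + y ∈ M) (hy : y ∈ M) :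
    x ∈ M := (M.add_mem_iff_left hy).1 h

theorem mem_of_add_mem_of_mem' {M : Submodule (ZMod 2) V} {x y : V} (h : x + y ∈ M) (hx : x ∈ M) :
    y ∈ M := (M.add_mem_iff_right hx).1 h

theorem zmod_two_eq (k : ZMod 2) : k = 0 ∨ k = 1 := by
  revert k; decide

theorem zmod_two_add_eq_one {k l : ZMod 2} (h : k ≠ l) : k + l = 1 := by
  revert k l; decide

namespace IsWeakCocycle

variable {c : V → V → V}

theorem add {d : V → V → V} (hc : IsWeakCocycle c) (hd : IsWeakCocycle d) :
    IsWeakCocycle (c + d) where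
  symm M a b ha hb := by
    have := M.add_mem (hc.symm M a b ha hb) (hd.symm M a b ha hb)
    convert this using 1
    simp only [Pi.add_apply]; abel
  self M a ha := M.add_mem (hc.self M a ha) (hd.self M a ha)
  zero M a ha := M.add_mem (hc.zero M a ha) (hd.zero M a ha)
  coc M x y z hx hy hz := by
    have := M.add_mem (hc.coc M x y z hx hy hz) (hd.coc M x y z hx hy hz)
    convert this using 1
    simp only [Pi.add_apply]; abel

theorem coboundary {g : V → V} (hg : g 0 = 0) :
    IsWeakCocycle (fun a b => g a + g b + g (a + b)) where
  symm M a b _ _ := by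
    convert M.zero_mem
    rw [add_comm b a, add_comm (g b), ZModModule.add_self]
  self M a _ := by simp [ZModModule.add_self, hg]
  zero M a _ := by simp [ZModModule.add_self, hg]
  coc M x y z _ _ _ := by
    convert M.zero_mem
    rw [← add_assoc x y z,
      ← ZModModule.add_self (g x + g y + g (x + y) + g z + g (x + y + z) + g (y + z))]
    abel

theorem twist (hc : IsWeakCocycle c) {g : V → V} (hg : g 0 = 0) : IsWeakCocycle (twist c g) :=
  hc.add (coboundary hg)

variable {M : Submodule (ZMod 2) V} {a b p q r f : V}

theorem swap_mem (hc : IsWeakCocycle c) (ha : a ∈ M) (hb : b ∈ M) (h : c a b ∈ M) : c b a ∈ M :=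
  mem_of_add_mem_of_mem' (hc.symm M a b ha hb) h

/-- The value on two points of a line agrees with the value on any other two points. -/
theorem third_point (hc : IsWeakCocycle c) (ha : a ∈ M) (hb : b ∈ M) :
    c a b + c a (a + b) ∈ M := by
  have h := hc.coc M a a b ha ha hb
  rw [ZModModule.add_self] at h
  exact mem_of_add_mem_of_mem' h (M.add_mem (hc.self M a ha) (hc.zero M b hb))

theorem third_point_mem (hc : IsWeakCocycle c) (ha : a ∈ M) (hb : b ∈ M) (h : c a b ∈ M) :
    c a (a + b) ∈ M :=
  mem_of_add_mem_of_mem' (hc.third_point ha hb) h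

/-- To vanish on `U ∪ (U + f)` it suffices to vanish on `U` and on `U + f`. -/
theorem vanishesOn_extend (hc : IsWeakCocycle c) {U : Submodule (ZMod 2) V} {S : Set V}
    (hS : ∀ v ∈ S, v ∈ U ∨ v + f ∈ U) (hU : VanishesOn c U)
    (hUf : ∀ p ∈ U, ∀ q ∈ U, ∀ M : Submodule (ZMod 2) V, p + f ∈ M → q + f ∈ M →
      c (p + f) (q + f) ∈ M) : VanishesOn c S := by
  have key : ∀ a, a ∈ U → ∀ b, b + f ∈ U → ∀ M : Submodule (ZMod 2) V, a ∈ M → b ∈ M →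
      c b a ∈ M := by
    intro a ha b hb M haM hbM
    have hab : a + b + f ∈ U := by rw [add_assoc]; exact U.add_mem ha hb
    have h := hUf _ hb _ hab M (by rwa [add_assoc, ZModModule.add_self, add_zero])
      (by rw [add_assoc, ZModModule.add_self, add_zero]; exact M.add_mem haM hbM)
    simp only [add_assoc, ZModModule.add_self, add_zero] at h
    have h2 := hc.third_point_mem hbM (M.add_mem haM hbM) h
    rwa [add_comm a b, ← add_assoc, ZModModule.add_self, zero_add] at h2
  intro a ha b hb M haM hbM
  rcases hS a ha with ha | ha <;> rcases hS b hb with hb | hb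
  · exact hU a ha b hb M haM hbM
  · exact hc.swap_mem hbM haM (key a ha b hb M haM hbM)
  · exact key b hb a ha M hbM haM
  · have h := hUf _ ha _ hb M (by rwa [add_assoc, ZModModule.add_self, add_zero])
      (by rwa [add_assoc, ZModModule.add_self, add_zero])
    simpa only [add_assoc, ZModModule.add_self, add_zero] using h

/-- `κ` records the failure of `c` to vanish on `U + f`. -/
def IsDefect (c : V → V → V) (U : Submodule (ZMod 2) V) (f : V) (κ : V → V → ZMod 2) : Prop :=
  ∀ p ∈ U, ∀ q ∈ U, ∀ M : Submodule (ZMod 2) V, p + f ∈ M → q + f ∈ M →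
    c (p + f) (q + f) + κ p q • p ∈ M

theorem exists_isDefect (hc : IsWeakCocycle c) {U : Submodule (ZMod 2) V}
    (hU : VanishesOn c U)
    (hf : ∀ p ∈ U, ∀ M : Submodule (ZMod 2) V, p ∈ M → f ∈ M → c p f ∈ M) :
    ∃ κ : V → V → ZMod 2, IsDefect c U f κ := by
  have key : ∀ p q : V, ∃ k : ZMod 2, p ∈ U → q ∈ U → ∀ M : Submodule (ZMod 2) V,
      p + f ∈ M → q + f ∈ M → c (p + f) (q + f) + k • p ∈ M := by
    intro p q
    by_cases hpq : p ∈ U ∧ q ∈ U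
    swap
    · exact ⟨0, fun h1 h2 => absurd ⟨h1, h2⟩ hpq⟩
    obtain ⟨hp, hq⟩ := hpq
    set N : Submodule (ZMod 2) V := Submodule.span (ZMod 2) {p, p + f, q + f} with hN
    have hpN : p ∈ N := Submodule.subset_span (by simp)
    have hpfN : p + f ∈ N := Submodule.subset_span (by simp)
    have hqfN : q + f ∈ N := Submodule.subset_span (by simp)
    have hfN : f ∈ N := mem_of_add_mem_of_mem' hpfN hpN
    have hqN : q ∈ N := mem_of_add_mem_of_mem hqfN hfN
    have h1 := hc.coc N p f (q + f) hpN hfN hqfN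
    have e : f + (q + f) = q := by
      rw [add_comm q f, ← add_assoc, ZModModule.add_self, zero_add]
    rw [e] at h1
    have h2 : c f (q + f) ∈ N := by
      rw [add_comm q f]
      exact hc.third_point_mem hfN hqN (hc.swap_mem hqN hfN (hf q hq N hqN hfN))
    have h3 := mem_of_add_mem_of_mem' (mem_of_add_mem_of_mem h1
      (N.add_mem h2 (hU p hp q hq N hpN hqN))) (hf p hp N hpN hfN)
    rw [hN, Submodule.mem_span_insert] at h3
    obtain ⟨k, z, hz, hk⟩ := h3
    refine ⟨k, fun _ _ M h1 h2 => ?_⟩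
    rw [hk, add_comm, ← add_assoc, ZModModule.add_self, zero_add]
    exact Submodule.span_le.2 (by rintro x (rfl | rfl) <;> assumption) hz
  choose κ hκ using key
  exact ⟨κ, fun p hp q hq M => hκ p q hp hq M⟩

/-- A point of `U` lying in `N + (p + f)` already lies in `N`. -/
theorem mem_of_mem_sup_span {U N : Submodule (ZMod 2) V} (hfU : f ∉ U) (hN : N ≤ U)
    (hp : p ∈ U) {x : V} (hx : x ∈ U) (h : x ∈ N ⊔ Submodule.span (ZMod 2) {p + f}) : x ∈ N := by
  obtain ⟨y, hy, z, hz, rfl⟩ := Submodule.mem_sup.1 h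
  obtain ⟨k, rfl⟩ := Submodule.mem_span_singleton.1 hz
  rcases zmod_two_eq k with rfl | rfl
  · simpa using hy
  · rw [one_smul] at hx
    exact absurd (mem_of_add_mem_of_mem' (mem_of_add_mem_of_mem' hx (hN hy)) hp) hfU

theorem IsDefect.eq_of_mem {U : Submodule (ZMod 2) V} {κ : V → V → ZMod 2}
    (hκ : IsDefect c U f κ) (hfU : f ∉ U) (hp : p ∈ U) (hq : q ∈ U) (hp0 : p ≠ 0) (hq0 : q ≠ 0)
    {k : ZMod 2}
    (h : ∀ M : Submodule (ZMod 2) V, p + f ∈ M → q + f ∈ M → c (p + f) (q + f) + k • p ∈ M) :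
    κ p q = k := by
  set N : Submodule (ZMod 2) V := Submodule.span (ZMod 2) {p + q} with hN
  have h1 : p + f ∈ N ⊔ Submodule.span (ZMod 2) {p + f} :=
    Submodule.mem_sup_right (Submodule.mem_span_singleton_self _)
  have h2 : q + f ∈ N ⊔ Submodule.span (ZMod 2) {p + f} := by
    have := Submodule.add_mem _ (Submodule.mem_sup_left (Submodule.mem_span_singleton_self (p + q)))
      h1
    rwa [add_add_add_comm, add_comm p q, add_assoc, ← add_assoc, add_comm q, add_assoc,
      ← add_assoc, ZModModule.add_self, zero_add] at this
  have h3 := Submodule.add_mem _ (hκ p hp q hq _ h1 h2) (h _ h1 h2)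
  rw [add_add_add_comm, ZModModule.add_self, zero_add, ← add_smul] at h3
  by_contra hne
  have h4 : κ p q + k = 1 := zmod_two_add_eq_one hne
  rw [h4, one_smul] at h3
  have h5 := mem_of_mem_sup_span hfU (by simpa [hN] using U.add_mem hp hq) hp hp h3
  obtain ⟨l, hl⟩ := Submodule.mem_span_singleton.1 h5
  rcases zmod_two_eq l with rfl | rfl
  · exact hp0 (by simpa using hl.symm)
  · exact hq0 (by simpa using hl)

theorem IsDefect.comm (hc : IsWeakCocycle c) {U : Submodule (ZMod 2) V} {κ : V → V → ZMod 2}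
    (hκ : IsDefect c U f κ) (hfU : f ∉ U) (hp : p ∈ U) (hq : q ∈ U) (hp0 : p ≠ 0) (hq0 : q ≠ 0) :
    κ p q = κ q p := by
  refine hκ.eq_of_mem hfU hp hq hp0 hq0 fun M h1 h2 => ?_
  have h3 := hκ q hq p hp M h2 h1
  have h4 := M.add_mem h3 (hc.symm M _ _ h1 h2)
  have h5 := M.add_mem h4 (M.smul_mem (κ q p) (M.add_mem h1 h2))
  convert h5 using 1
  rcases zmod_two_eq (κ q p) with h | h <;> rw [h]
  · simp only [zero_smul, add_zero]
    rw [add_comm (c (p + f) (q + f)), ← add_assoc, ZModModule.add_self, zero_add]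
  · simp only [one_smul]
    rw [← add_zero (c (p + f) (q + f) + p), ← ZModModule.add_self (c (q + f) (p + f) + f + q)]
    abel

theorem IsDefect.self (hc : IsWeakCocycle c) {U : Submodule (ZMod 2) V} {κ : V → V → ZMod 2}
    (hκ : IsDefect c U f κ) (hfU : f ∉ U) (hp : p ∈ U) (hp0 : p ≠ 0) : κ p p = 0 :=
  hκ.eq_of_mem hfU hp hp hp0 hp0 fun M h1 _ => by simpa using hc.self M _ h1

theorem IsDefect.triangle (hc : IsWeakCocycle c) {U : Submodule (ZMod 2) V}
    {κ : V → V → ZMod 2} (hU : VanishesOn c U)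
    (hκ : IsDefect c U f κ) (hfU : f ∉ U) (hp : p ∈ U) (hq : q ∈ U) (hr : r ∈ U)
    (hi : p ∉ Submodule.span (ZMod 2) {p + q, q + r}) : κ p q + κ q r + κ p r = 0 := by
  set N : Submodule (ZMod 2) V := Submodule.span (ZMod 2) {p + q, q + r} with hN
  set M := N ⊔ Submodule.span (ZMod 2) {p + f} with hM
  have hpq : p + q ∈ M := Submodule.mem_sup_left (Submodule.subset_span (by simp))
  have hqr : q + r ∈ M := Submodule.mem_sup_left (Submodule.subset_span (by simp))
  have hpf : p + f ∈ M := Submodule.mem_sup_right (Submodule.mem_span_singleton_self _)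
  have hqf : q + f ∈ M := by
    convert M.add_mem hpq hpf using 1
    rw [← add_zero (q + f), ← ZModModule.add_self p]; abel
  have hrf : r + f ∈ M := by
    convert M.add_mem hqr hqf using 1
    rw [← add_zero (r + f), ← ZModModule.add_self q]; abel
  have hpr : p + r ∈ M := by
    convert M.add_mem hpq hqr using 1
    rw [← add_zero (p + r), ← ZModModule.add_self q]; abel
  have aux : ∀ x y : V, x ∈ U → y ∈ U → x + f ∈ M → y + f ∈ M →
      c (x + y) (x + f) + κ x y • x ∈ M := by
    intro x y hx hy hxf hyf
    have h1 := hc.third_point hxf hyf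
    have e : x + f + (y + f) = x + y := by
      rw [← add_zero (x + y), ← ZModModule.add_self f]; abel
    rw [e] at h1
    have h2 := hc.symm M (x + f) (x + y) hxf (by rw [← e]; exact M.add_mem hxf hyf)
    have h3 := M.add_mem (M.add_mem h1 h2) (hκ x hx y hy M hxf hyf)
    convert h3 using 1
    rw [← add_zero (_ + κ x y • x), ← ZModModule.add_self (c (x + f) (y + f) + c (x + f) (x + y))]
    abel
  have h1 := hc.coc M (q + r) (p + q) (p + f) hqr hpq hpf
  have e1 : q + r + (p + q) = p + r := by
    rw [← add_zero (p + r), ← ZModModule.add_self q]; abel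
  have e2 : p + q + (p + f) = q + f := by
    rw [← add_zero (q + f), ← ZModModule.add_self p]; abel
  rw [e1, e2] at h1
  have h2 := hU (q + r) (U.add_mem hq hr) (p + q) (U.add_mem hp hq) M hqr hpq
  have h3 := M.add_mem (M.add_mem (aux p r hp hr hpf hrf) (aux p q hp hq hpf hqf))
    (aux q r hq hr hqf hrf)
  have h4 := M.add_mem (M.add_mem (M.add_mem h1 h2) h3) (M.smul_mem (κ q r) hpq)
  have h5 : (κ p q + κ q r + κ p r) • p ∈ M := by
    convert h4 using 1
    rw [← add_zero ((κ p q + κ q r + κ p r) • p), ← ZModModule.add_self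
      (c (q + r) (p + q) + c (p + r) (p + f) + c (p + q) (p + f) + c (q + r) (q + f) +
        κ q r • q)]
    simp only [add_smul, smul_add]
    abel
  rcases zmod_two_eq (κ p q + κ q r + κ p r) with h | h
  · exact h
  · rw [h, one_smul] at h5
    refine absurd (mem_of_mem_sup_span hfU ?_ hp hp h5) hi
    exact Submodule.span_le.2 (by
      rintro x (rfl | rfl)
      exacts [U.add_mem hp hq, U.add_mem hq hr])

/-- If the defect is a coboundary, then `c` can be made to vanish on `U ∪ (U + f)`. -/
theorem exists_vanishesOn_of_defect (hc : IsWeakCocycle c) {U : Submodule (ZMod 2) V} {S : Set V}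
    {κ : V → V → ZMod 2} {l : V → ZMod 2} (hS : ∀ v ∈ S, v ∈ U ∨ v + f ∈ U)
    (hU : VanishesOn c U)
    (hf : ∀ p ∈ U, ∀ M : Submodule (ZMod 2) V, p ∈ M → f ∈ M → c p f ∈ M)
    (hκ : IsDefect c U f κ) (hfU : f ∉ U)
    (hl : ∀ p ∈ U, ∀ q ∈ U, p ≠ 0 → q ≠ 0 → κ p q = l p + l q) :
    ∃ g : V → V, g 0 = 0 ∧ VanishesOn (_root_.twist c g) S := by
  classical
  set g : V → V := fun v => if v ∈ U then 0 else l (v + f) • (v + f) with hg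
  have hgU : ∀ v ∈ U, g v = 0 := fun v hv => by simp [hg, hv]
  have hgf : ∀ v ∈ U, g (v + f) = l v • v := by
    intro v hv
    have : v + f ∉ U := fun h => hfU (mem_of_add_mem_of_mem' h hv)
    simp [hg, this, add_assoc, ZModModule.add_self]
  have hg0 : g 0 = 0 := hgU 0 U.zero_mem
  refine ⟨g, hg0, (hc.twist hg0).vanishesOn_extend hS ?_ ?_⟩
  · intro a ha b hb M haM hbM
    simp only [_root_.twist, hgU a ha, hgU b hb, hgU _ (U.add_mem ha hb), add_zero]
    exact hU a ha b hb M haM hbM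
  · intro p hp q hq M hpM hqM
    have hpq : p + f + (q + f) = p + q := by
      rw [← add_zero (p + q), ← ZModModule.add_self f]; abel
    have hpqM : p + q ∈ M := by rw [← hpq]; exact M.add_mem hpM hqM
    simp only [_root_.twist, hpq, hgf p hp, hgf q hq, hgU _ (U.add_mem hp hq), add_zero]
    have hcf : ∀ q ∈ U, q ∈ M → f ∈ M → c (0 + f) (q + f) ∈ M := by
      intro q hq hqM hfM
      rw [zero_add, add_comm q f]
      exact hc.third_point_mem hfM hqM (hc.swap_mem hqM hfM (hf q hq M hqM hfM))
    rcases eq_or_ne p 0 with rfl | hp0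
    · rw [zero_add] at hpM hpqM
      exact M.add_mem (hcf q hq hpqM hpM) (by simpa using M.smul_mem _ hpqM)
    rcases eq_or_ne q 0 with rfl | hq0
    · rw [add_zero] at hpqM
      refine M.add_mem (hc.swap_mem hqM hpM (hcf p hp hpqM ?_)) (by simpa using M.smul_mem _ hpqM)
      rwa [zero_add] at hqM
    have h1 := M.add_mem (hκ p hp q hq M hpM hqM) (M.smul_mem (l q) hpqM)
    rw [hl p hp q hq hp0 hq0] at h1
    convert h1 using 1
    rw [← add_zero (_ + (_ + _)), ← ZModModule.add_self (l q • p)]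
    simp only [add_smul, smul_add]
    abel

theorem exists_normalization (hc : IsWeakCocycle c) {U : Submodule (ZMod 2) V}
    (hU : VanishesOn c U) (hfU : f ∉ U) :
    ∃ g : V → V, g 0 = 0 ∧ VanishesOn (_root_.twist c g) U ∧
      ∀ p ∈ U, ∀ M : Submodule (ZMod 2) V, p ∈ M → f ∈ M → _root_.twist c g p f ∈ M := by
  classical
  set g : V → V := fun v => if v ∈ U then 0 else c (v + f) f with hg
  have hgU : ∀ v ∈ U, g v = 0 := fun v hv => by simp [hg, hv]
  have hgf : ∀ v ∈ U, g (v + f) = c v f := by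
    intro v hv
    have : v + f ∉ U := fun h => hfU (mem_of_add_mem_of_mem' h hv)
    simp [hg, this, add_assoc, ZModModule.add_self]
  refine ⟨g, hgU 0 U.zero_mem, ?_, ?_⟩
  · intro a ha b hb M haM hbM
    simp only [_root_.twist, hgU a ha, hgU b hb, hgU _ (U.add_mem ha hb), add_zero]
    exact hU a ha b hb M haM hbM
  · intro p hp M _ hfM
    have h := hgf 0 U.zero_mem
    rw [zero_add] at h
    simp only [_root_.twist, hgU p hp, h, hgf p hp, zero_add]
    convert hc.zero M f hfM using 1
    rw [add_comm (c 0 f), ← add_assoc, ZModModule.add_self, zero_add]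

/-- If every pair of elements of `U` misses a vector of `U`, the defect is a coboundary. -/
theorem IsDefect.exists_primitive (hc : IsWeakCocycle c) {U : Submodule (ZMod 2) V}
    {κ : V → V → ZMod 2} (hU : VanishesOn c U) (hκ : IsDefect c U f κ) (hfU : f ∉ U)
    (hdim : ∀ x y : V, ∃ d ∈ U, d ∉ Submodule.span (ZMod 2) {x, y}) :
    ∃ l : V → ZMod 2, ∀ p ∈ U, ∀ q ∈ U, p ≠ 0 → q ≠ 0 → κ p q = l p + l q := by
  obtain ⟨o, ho, ho'⟩ := hdim 0 0
  have ho0 : o ≠ 0 := by rintro rfl; exact ho' (Submodule.zero_mem _)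
  have indep : ∀ x y z : V, x ≠ 0 → y ≠ 0 → x ≠ y → z ∉ Submodule.span (ZMod 2) {x, y} →
      z ∉ Submodule.span (ZMod 2) {z + x, x + y} := by
    intro x y z hx hy hxy hz h
    obtain ⟨i, j, h⟩ := Submodule.mem_span_pair.1 h
    rcases zmod_two_eq i with rfl | rfl <;> rcases zmod_two_eq j with rfl | rfl
    · simp only [zero_smul, add_zero] at h
      exact hz (h ▸ Submodule.zero_mem _)
    · simp only [zero_smul, one_smul, zero_add] at h
      exact hz (h ▸ Submodule.mem_span_pair.2 ⟨1, 1, by simp⟩)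
    · simp only [zero_smul, one_smul, add_zero] at h
      exact hx (by simpa using h)
    · simp only [one_smul] at h
      apply hy
      have : z + x + (x + y) = z + y + (x + x) := by abel
      rw [this, ZModModule.add_self, add_zero] at h
      simpa using h
  have tri : ∀ x ∈ U, ∀ y ∈ U, ∀ z ∈ U, x ≠ 0 → y ≠ 0 → x ≠ y →
      z ∉ Submodule.span (ZMod 2) {x, y} → κ x y = κ x z + κ y z := by
    intro x hx y hy z hz hx0 hy0 hxy hzs
    have hz0 : z ≠ 0 := by rintro rfl; exact hzs (Submodule.zero_mem _)
    have h := IsDefect.triangle hc hU hκ hfU hz hx hy (indep x y z hx0 hy0 hxy hzs)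
    rw [IsDefect.comm hc hκ hfU hz hx hz0 hx0, IsDefect.comm hc hκ hfU hz hy hz0 hy0] at h
    generalize κ x y = u at *
    generalize κ x z = v at *
    generalize κ y z = w at *
    revert u v w
    decide +revert
  refine ⟨fun p => κ p o, fun p hp q hq hp0 hq0 => ?_⟩
  rcases eq_or_ne p q with rfl | hpq
  · rw [IsDefect.self hc hκ hfU hp hp0, ZModModule.add_self]
  by_cases hos : o ∈ Submodule.span (ZMod 2) {p, q}
  swap
  · exact tri p hp q hq o ho hp0 hq0 hpq hos
  rcases eq_or_ne p o with rfl | hpo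
  · simp only [IsDefect.self hc hκ hfU hp hp0, zero_add]
    exact IsDefect.comm hc hκ hfU hp hq hp0 hq0
  rcases eq_or_ne q o with rfl | hqo
  · simp only [IsDefect.self hc hκ hfU hq hq0, add_zero]
  obtain ⟨d, hd, hds⟩ := hdim p q
  have hle : ∀ x ∈ Submodule.span (ZMod 2) {p, q}, d ∉ Submodule.span (ZMod 2) {x, o} := by
    intro x hx h
    refine hds (Submodule.span_le.2 ?_ h)
    rintro y (rfl | rfl) <;> assumption
  show κ p q = κ p o + κ q o
  rw [tri p hp q hq d hd hp0 hq0 hpq hds,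
    tri p hp o ho d hd hp0 ho0 hpo (hle p (Submodule.subset_span (by simp))),
    tri q hq o ho d hd hq0 ho0 hqo (hle q (Submodule.subset_span (by simp))),
    add_add_add_comm, ZModModule.add_self, add_zero]

/-- `c` is cohomologous to a weak cocycle vanishing on `S`. -/
def TrivialOn (c : V → V → V) (S : Set V) : Prop :=
  ∃ g : V → V, g 0 = 0 ∧ VanishesOn (_root_.twist c g) S

theorem TrivialOn.extend (hc : IsWeakCocycle c) {U : Submodule (ZMod 2) V} {S : Set V}
    (h : TrivialOn c U) (hS : ∀ v ∈ S, v ∈ U ∨ v + f ∈ U) (hfU : f ∉ U)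
    (hprim : ∀ (d : V → V → V) (κ : V → V → ZMod 2), IsWeakCocycle d → VanishesOn d U →
      IsDefect d U f κ → ∃ l : V → ZMod 2, ∀ p ∈ U, ∀ q ∈ U, p ≠ 0 → q ≠ 0 → κ p q = l p + l q) :
    TrivialOn c S := by
  obtain ⟨g, hg, hgU⟩ := h
  have hcg := hc.twist hg
  obtain ⟨g', hg', hgU', hgf⟩ := hcg.exists_normalization hgU hfU
  have hcg' := hcg.twist hg'
  obtain ⟨κ, hκ⟩ := hcg'.exists_isDefect hgU' hgf
  obtain ⟨l, hl⟩ := hprim _ κ hcg' hgU' hκ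
  obtain ⟨g'', hg'', hv⟩ := hcg'.exists_vanishesOn_of_defect hS hgU' hgf hκ hfU hl
  refine ⟨g + g' + g'', by simp [hg, hg', hg''], ?_⟩
  rwa [← twist_twist, ← twist_twist]

end IsWeakCocycle
/-- The vectors supported on the first `k` coordinates. -/
def initialVectors (n k : ℕ) : Submodule (ZMod 2) (Fin n → ZMod 2) where
  carrier := {a | ∀ i : Fin n, k ≤ i.val → a i = 0}
  add_mem' ha hb i hi := by simp [ha i hi, hb i hi]
  zero_mem' i _ := rfl
  smul_mem' r a ha i hi := by simp [ha i hi]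

theorem mem_initialVectors_succ {n k : ℕ} (hk : k < n) {a : Fin n → ZMod 2}
    (ha : a ∈ initialVectors n (k + 1)) :
    a ∈ initialVectors n k ∨ a + Pi.single ⟨k, hk⟩ 1 ∈ initialVectors n k := by
  rcases zmod_two_eq (a ⟨k, hk⟩) with h | h
  · left
    intro i hi
    rcases hi.eq_or_lt with rfl | hi
    · exact h
    · exact ha i hi
  · right
    intro i hi
    rcases hi.eq_or_lt with rfl | hi'
    · simp only [Pi.add_apply, h, Pi.single_eq_same]; decide
    · have : i ≠ ⟨k, hk⟩ := by rintro rfl; simp at hi'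
      simp [ha i hi', this]

theorem single_notMem_initialVectors {n k : ℕ} (hk : k < n) :
    Pi.single ⟨k, hk⟩ 1 ∉ initialVectors n k := by
  intro h
  simpa using h ⟨k, hk⟩ le_rfl

theorem single_mem_initialVectors {n k j : ℕ} (hj : j < n) (hjk : j < k) :
    Pi.single ⟨j, hj⟩ 1 ∈ initialVectors n k := by
  intro i hi
  have : i ≠ ⟨j, hj⟩ := by rintro rfl; simp at hi; omega
  simp [this]

theorem exists_mem_initialVectors_notMem_span_pair {n k : ℕ} (hk : 3 ≤ k) (hkn : k ≤ n)
    (x y : Fin n → ZMod 2) :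
    ∃ d ∈ initialVectors n k, d ∉ Submodule.span (ZMod 2) {x, y} := by
  by_contra! hcon
  have h0 := hcon _ (single_mem_initialVectors (n := n) (j := 0) (by omega) (by omega))
  have h1 := hcon _ (single_mem_initialVectors (n := n) (j := 1) (by omega) (by omega))
  have h2 := hcon _ (single_mem_initialVectors (n := n) (j := 2) (by omega) (by omega))
  have hli : LinearIndependent (ZMod 2)
      (fun i : Fin 3 => (Pi.single ⟨i.val, by omega⟩ 1 : Fin n → ZMod 2)) :=
    (Pi.linearIndependent_single_one (Fin n) (ZMod 2)).comp
      (fun i : Fin 3 => (⟨i.val, by omega⟩ : Fin n)) (fun i j h => by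
        simpa [Fin.ext_iff] using h)
  have hle : Submodule.span (ZMod 2) (Set.range
      (fun i : Fin 3 => (Pi.single ⟨i.val, by omega⟩ 1 : Fin n → ZMod 2))) ≤
      Submodule.span (ZMod 2) {x, y} := by
    rw [Submodule.span_le]
    rintro _ ⟨i, rfl⟩
    fin_cases i <;> assumption
  have hr := Submodule.finrank_mono hle
  rw [finrank_span_eq_card hli] at hr
  have := finrank_span_finset_le_card (R := ZMod 2) ({x, y} : Finset (Fin n → ZMod 2))
  have := Finset.card_le_two (a := x) (b := y)
  rw [Finset.coe_pair] at *
  simp only [Set.finrank, Fintype.card_fin] at *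
  omega

theorem mul_mem_of_mem_initialVectors_two {n : ℕ} {a b : Fin n → ZMod 2}
    {M : Submodule (ZMod 2) (Fin n → ZMod 2)} (ha : a ∈ initialVectors n 2)
    (hb : b ∈ initialVectors n 2) (haM : a ∈ M) (hbM : b ∈ M) : a * b ∈ M := by
  have key : ∀ a₀ a₁ b₀ b₁ : ZMod 2, ∃ i j : ZMod 2,
      a₀ * b₀ = i * a₀ + j * b₀ ∧ a₁ * b₁ = i * a₁ + j * b₁ := by decide
  obtain ⟨i, j, h₀, h₁⟩ := key (if h : 0 < n then a ⟨0, h⟩ else 0)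
    (if h : 1 < n then a ⟨1, h⟩ else 0) (if h : 0 < n then b ⟨0, h⟩ else 0)
    (if h : 1 < n then b ⟨1, h⟩ else 0)
  have : a * b = i • a + j • b := by
    funext ⟨k, hk⟩
    simp only [Pi.mul_apply, Pi.add_apply, Pi.smul_apply, smul_eq_mul]
    match k, hk with
    | 0, hk => simpa [hk] using h₀
    | 1, hk => simpa [hk] using h₁
    | k + 2, hk => simp [ha ⟨k + 2, hk⟩ (by simp), hb ⟨k + 2, hk⟩ (by simp)]
  rw [this]
  exact M.add_mem (M.smul_mem i haM) (M.smul_mem j hbM)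

theorem isWeakCocycle_mul (n : ℕ) :
    IsWeakCocycle (fun a b : Fin n → ZMod 2 => a * b) where
  symm M a b _ _ := by rw [mul_comm b a, ZModModule.add_self]; exact M.zero_mem
  self M a ha := by
    have : a * a = a := by
      funext i
      rcases zmod_two_eq (a i) with h | h <;> simp [h]
    rwa [this]
  zero M a _ := by simp
  coc M a b d _ _ _ := by
    have : a * b + (a + b) * d + (b * d + a * (b + d)) =
        (a * b + (a + b) * d) + (a * b + (a + b) * d) := by ring
    rw [this, ZModModule.add_self]
    exact M.zero_mem

namespace IsWeakCocycle

variable {n : ℕ} {c : (Fin n → ZMod 2) → (Fin n → ZMod 2) → (Fin n → ZMod 2)}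

theorem trivialOn_initialVectors_of_le_two (hc : IsWeakCocycle c) {k : ℕ} (hk2 : k ≤ 2)
    (hkn : k ≤ n) : TrivialOn c (initialVectors n k) := by
  induction k with
  | zero =>
    refine ⟨0, rfl, fun a ha b hb M _ hb => ?_⟩
    have : a = 0 := funext fun i => ha i (Nat.zero_le _)
    subst this
    simpa [_root_.twist] using hc.zero M b hb
  | succ k ih =>
    have hk := Nat.lt_of_succ_le hkn
    refine (ih (by omega) (by omega)).extend hc (f := Pi.single ⟨k, hk⟩ 1)
      (fun v hv => mem_initialVectors_succ hk hv) (single_notMem_initialVectors hk)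
      fun d κ hd _ hκ => ⟨0, fun p hp q hq hp0 hq0 => ?_⟩
    have hpq : p = q := by
      have key : ∀ v ∈ initialVectors n k, v ≠ 0 → v = Pi.single ⟨0, by omega⟩ 1 := by
        intro v hv hv0
        rcases mem_initialVectors_succ (k := 0) (by omega)
          (fun i hi => hv i (by omega) : v ∈ initialVectors n (0 + 1)) with h | h
        · exact absurd (funext fun i => h i (Nat.zero_le _)) hv0
        · have : v + Pi.single ⟨0, by omega⟩ 1 = 0 := funext fun i => h i (Nat.zero_le _)
          rwa [← sub_eq_zero, ZModModule.sub_eq_add]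
      rw [key p hp hp0, key q hq hq0]
    subst hpq
    simpa using IsDefect.self hd hκ (single_notMem_initialVectors hk) hp hp0

theorem IsDefect.exists_primitive_of_plane (hc : IsWeakCocycle c) (hn : 2 < n)
    {κ : (Fin n → ZMod 2) → (Fin n → ZMod 2) → ZMod 2}
    {e₀ e₁ : Fin n → ZMod 2} (he₀ : e₀ = Pi.single ⟨0, by omega⟩ 1)
    (he₁ : e₁ = Pi.single ⟨1, by omega⟩ 1)
    (hκ : IsDefect c (initialVectors n 2) (Pi.single ⟨2, hn⟩ 1) κ)
    (hsum : κ e₀ e₁ + κ e₀ (e₀ + e₁) + κ e₁ (e₀ + e₁) = 0) :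
    ∃ l : (Fin n → ZMod 2) → ZMod 2, ∀ p ∈ initialVectors n 2, ∀ q ∈ initialVectors n 2,
      p ≠ 0 → q ≠ 0 → κ p q = l p + l q := by
  have key : ∀ v ∈ initialVectors n 2, v ≠ 0 → v = e₀ ∨ v = e₁ ∨ v = e₀ + e₁ := by
    intro v hv hv0
    have aux : ∀ v ∈ initialVectors n 1, v = 0 ∨ v = e₀ := by
      intro v hv
      rcases mem_initialVectors_succ (k := 0) (by omega) hv with h | h
      · exact Or.inl (funext fun i => h i (Nat.zero_le _))
      · right
        rw [← sub_eq_zero, ZModModule.sub_eq_add, he₀]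
        exact funext fun i => h i (Nat.zero_le _)
    rcases mem_initialVectors_succ (k := 1) (by omega) hv with h | h
    · rcases aux v h with h | h
      · exact absurd h hv0
      · exact Or.inl h
    · rw [← he₁] at h
      have e : v = v + e₁ + e₁ := by rw [add_assoc, ZModModule.add_self, add_zero]
      rcases aux _ h with h | h <;> rw [h] at e
      · simp [e]
      · exact Or.inr (Or.inr e)
  have hfU := single_notMem_initialVectors hn
  have comm := fun p hp q hq hp0 hq0 => IsDefect.comm hc hκ hfU (p := p) (q := q) hp hq hp0 hq0
  have self := fun p hp hp0 => IsDefect.self hc hκ hfU (p := p) hp hp0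
  refine ⟨fun p => κ p (e₀ + e₁), fun p hp q hq hp0 hq0 => ?_⟩
  have h₀ : e₀ ∈ initialVectors n 2 := he₀ ▸ single_mem_initialVectors (by omega) (by omega)
  have h₁ : e₁ ∈ initialVectors n 2 := he₁ ▸ single_mem_initialVectors (by omega) (by omega)
  have hk : κ e₀ e₁ = κ e₀ (e₀ + e₁) + κ e₁ (e₀ + e₁) := by
    rwa [← sub_eq_zero, ZModModule.sub_eq_add, ← add_assoc]
  have hz : ∀ k : ZMod 2, k + k = 0 := by decide
  show κ p q = κ p (e₀ + e₁) + κ q (e₀ + e₁)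
  rcases key p hp hp0 with rfl | rfl | rfl <;> rcases key q hq hq0 with rfl | rfl | rfl
  · rw [self _ hp hp0, hz]
  · exact hk
  · rw [self _ hq hq0, add_zero]
  · rw [comm _ hp _ hq hp0 hq0, hk, add_comm]
  · rw [self _ hp hp0, hz]
  · rw [self _ hq hq0, add_zero]
  · rw [comm _ hp _ hq hp0 hq0, self _ hp hp0, zero_add]
  · rw [comm _ hp _ hq hp0 hq0, self _ hp hp0, zero_add]
  · rw [self _ hp hp0, hz]

theorem trivialOn_initialVectors_three (hc : IsWeakCocycle c) (hn : 2 < n) :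
    TrivialOn c (initialVectors n 3) ∨
      TrivialOn (c + fun a b => a * b) (initialVectors n 3) := by
  obtain ⟨g, hg, hgU⟩ := hc.trivialOn_initialVectors_of_le_two (k := 2) le_rfl (by omega)
  have hfU := single_notMem_initialVectors hn
  have hcg := hc.twist hg
  obtain ⟨g', hg', hgU', hgf⟩ := hcg.exists_normalization hgU hfU
  have hcg' := hcg.twist hg'
  rw [twist_twist] at hcg' hgU' hgf
  have hgg : (g + g') 0 = 0 := by simp [hg, hg']
  generalize g + g' = h at *
  set e₀ : Fin n → ZMod 2 := Pi.single ⟨0, by omega⟩ 1 with he₀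
  set e₁ : Fin n → ZMod 2 := Pi.single ⟨1, by omega⟩ 1 with he₁
  set f : Fin n → ZMod 2 := Pi.single ⟨2, hn⟩ 1 with hf
  have h₀ : e₀ ∈ initialVectors n 2 := he₀ ▸ single_mem_initialVectors (by omega) (by omega)
  have h₁ : e₁ ∈ initialVectors n 2 := he₁ ▸ single_mem_initialVectors (by omega) (by omega)
  have hmulf : ∀ p ∈ initialVectors n 2, p * f = 0 := by
    intro p hp
    funext i
    by_cases hi : i = ⟨2, hn⟩
    · subst hi; simp [hp ⟨2, hn⟩ le_rfl]
    · simp [hf, hi]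
  have hee : ∀ i : Fin n, (Pi.single i 1 : Fin n → ZMod 2) * Pi.single i 1 = Pi.single i 1 :=
    fun i => by rw [← Pi.single_mul, one_mul]
  have h01 : e₀ * e₁ = 0 := by
    funext i
    by_cases hi : i = ⟨0, by omega⟩
    · subst hi; simp [he₁]
    · simp [he₀, hi]
  obtain ⟨κ, hκ⟩ := hcg'.exists_isDefect hgU' hgf
  rcases zmod_two_eq (κ e₀ e₁ + κ e₀ (e₀ + e₁) + κ e₁ (e₀ + e₁)) with hs | hs
  · left
    obtain ⟨l, hl⟩ := hκ.exists_primitive_of_plane hcg' hn he₀ he₁ hs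
    obtain ⟨g'', hg'', hv⟩ := hcg'.exists_vanishesOn_of_defect
      (fun v hv => mem_initialVectors_succ hn hv) hgU' hgf hκ hfU hl
    exact ⟨h + g'', by simp [hgg, hg''], by rwa [← twist_twist]⟩
  · right
    have hd := hcg'.add (isWeakCocycle_mul n)
    have hdU : VanishesOn (_root_.twist c h + fun a b => a * b) (initialVectors n 2) := by
      intro a ha b hb M haM hbM
      exact M.add_mem (hgU' a ha b hb M haM hbM) (mul_mem_of_mem_initialVectors_two ha hb haM hbM)
    have hdf : ∀ p ∈ initialVectors n 2, ∀ M : Submodule (ZMod 2) (Fin n → ZMod 2), p ∈ M →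
        f ∈ M → (_root_.twist c h + (fun a b => a * b : _ → _ → Fin n → ZMod 2)) p f ∈ M := by
      intro p hp M hpM hfM
      simp only [Pi.add_apply, hmulf p hp, add_zero]
      exact hgf p hp M hpM hfM
    obtain ⟨κ', hκ'⟩ := hd.exists_isDefect hdU hdf
    have hmul : ∀ p ∈ initialVectors n 2, ∀ q ∈ initialVectors n 2,
        (p + f) * (q + f) = p * q + f := by
      intro p hp q hq
      rw [add_mul, mul_add, mul_add, hmulf p hp, mul_comm f q, hmulf q hq, hf, hee]
      simp
    have hshift : ∀ p ∈ initialVectors n 2, ∀ q ∈ initialVectors n 2, p ≠ 0 → q ≠ 0 →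
        ∀ k : ZMod 2, p * q + f = p + f + k • p → κ' p q = κ p q + k := by
      intro p hp q hq hp0 hq0 k hk
      refine hκ'.eq_of_mem hfU hp hq hp0 hq0 fun M hpM hqM => ?_
      have h1 := M.add_mem (hκ p hp q hq M hpM hqM) hpM
      convert h1 using 1
      simp only [Pi.add_apply, hmul p hp q hq, hk]
      rw [← add_zero (_ + κ p q • p + _), ← ZModModule.add_self (k • p)]
      simp only [add_smul]
      abel
    have he₀0 : e₀ ≠ 0 := by simp [he₀]
    have he₁0 : e₁ ≠ 0 := by simp [he₁]
    have he₀₁0 : e₀ + e₁ ≠ 0 := by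
      intro h
      have := congrFun h ⟨0, by omega⟩
      simp [he₀, he₁] at this
    have hs' : κ' e₀ e₁ + κ' e₀ (e₀ + e₁) + κ' e₁ (e₀ + e₁) = 0 := by
      rw [hshift e₀ h₀ e₁ h₁ he₀0 he₁0 1
          (by rw [h01, one_smul, add_right_comm, ZModModule.add_self]),
        hshift e₀ h₀ _ (Submodule.add_mem _ h₀ h₁) he₀0 he₀₁0 0
          (by rw [mul_add, h01, zero_smul, hee]; simp [he₀]),
        hshift e₁ h₁ _ (Submodule.add_mem _ h₀ h₁) he₁0 he₀₁0 0
          (by rw [mul_add, mul_comm, h01, zero_smul, hee]; simp [he₁])]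
      have e : κ e₀ e₁ + 1 + (κ e₀ (e₀ + e₁) + 0) + (κ e₁ (e₀ + e₁) + 0) =
        κ e₀ e₁ + κ e₀ (e₀ + e₁) + κ e₁ (e₀ + e₁) + 1 := by ring
      rw [e, hs]; decide
    obtain ⟨l, hl⟩ := hκ'.exists_primitive_of_plane hd hn he₀ he₁ hs'
    obtain ⟨g'', hg'', hv⟩ := hd.exists_vanishesOn_of_defect
      (fun v hv => mem_initialVectors_succ hn hv) hdU hdf hκ' hfU hl
    refine ⟨h + g'', by simp [hgg, hg''], ?_⟩
    have e : _root_.twist c h + (fun a b => a * b) =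
        _root_.twist (c + fun a b => a * b) h := by
      funext a b
      simp only [_root_.twist, Pi.add_apply]
      abel
    rwa [e, twist_twist] at hv

theorem trivialOn_initialVectors_of_three_le (hc : IsWeakCocycle c)
    (h3 : TrivialOn c (initialVectors n 3)) {k : ℕ} (hk : 3 ≤ k) (hkn : k ≤ n) :
    TrivialOn c (initialVectors n k) := by
  induction k, hk using Nat.le_induction with
  | base => exact h3
  | succ k hk ih =>
    have hkn' := Nat.lt_of_succ_le hkn
    have hfU := single_notMem_initialVectors hkn'
    exact (ih (by omega)).extend hc (fun v hv => mem_initialVectors_succ hkn' hv) hfU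
      fun d κ hd hdU hκ => hκ.exists_primitive hd hdU hfU
        (exists_mem_initialVectors_notMem_span_pair hk (by omega))

/-- Up to coboundaries there are at most two weak cocycles. -/
theorem trivialOn_univ (hc : IsWeakCocycle c) :
    TrivialOn c Set.univ ∨ TrivialOn (c + fun a b => a * b) Set.univ := by
  have huniv : (initialVectors n n : Set (Fin n → ZMod 2)) = Set.univ :=
    Set.eq_univ_of_forall fun v i hi => absurd i.isLt (by omega)
  rw [← huniv]
  rcases Nat.lt_or_ge 2 n with hn | hn
  · rcases hc.trivialOn_initialVectors_three hn with h | h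
    · exact Or.inl (hc.trivialOn_initialVectors_of_three_le h hn le_rfl)
    · exact Or.inr ((hc.add (isWeakCocycle_mul n)).trivialOn_initialVectors_of_three_le h hn
        le_rfl)
  · exact Or.inl (hc.trivialOn_initialVectors_of_le_two hn le_rfl)

end IsWeakCocycle

end Cocycle

namespace TwoValuedGroup

section Model

variable {T : Type u} {n : ℕ}

/-- `π` presents `X` as an extension of `V` by itself, twisted by the weak cocycle `c`. -/
structure IsModel {V : Type v} [AddCommGroup V] (X : TwoValuedGroup T) (c : V → V → V)
    (π : V → V → T) : Prop where
  surj : ∀ x, ∃ a b, π a b = x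
  one : π 0 0 = X.e
  eq_iff : ∀ a b a' b', π a b = π a' b' ↔ a = a' ∧ (b = b' ∨ b = b' + a)
  mul : ∀ a b a' b', X.mul (π a b) (π a' b') =
    {π (a + a') (b + b' + c a a'), π (a + a') (b + b' + c a a' + a)}

theorem IsModel.isomorphic {V : Type w} [AddCommGroup V] {S : Type v} {X : TwoValuedGroup T}
    {Y : TwoValuedGroup S} {c : V → V → V} {π : V → V → T} {π' : V → V → S} (h : IsModel X c π)
    (h' : IsModel Y c π') : Isomorphic X Y := by
  choose α β hαβ using h.surj
  set f : T → S := fun x => π' (α x) (β x) with hf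
  have key : ∀ a b, f (π a b) = π' a b := by
    intro a b
    exact (h'.eq_iff _ _ _ _).2 ((h.eq_iff _ _ _ _).1 (hαβ (π a b)))
  refine ⟨f, ⟨?_, ?_⟩, ?_, ?_⟩
  · intro x y hxy
    have := (h.eq_iff _ _ _ _).2 ((h'.eq_iff _ _ _ _).1 hxy)
    rwa [hαβ, hαβ] at this
  · intro y
    obtain ⟨a, b, rfl⟩ := h'.surj y
    exact ⟨π a b, key a b⟩
  · rw [← h.one, key, h'.one]
  · intro x y
    obtain ⟨a, b, rfl⟩ := h.surj x
    obtain ⟨a', b', rfl⟩ := h.surj y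
    simp only [h.mul, key, h'.mul, Multiset.insert_eq_cons, Multiset.map_cons,
      Multiset.map_singleton]

theorem IsModel.of_twist {V : Type v} [AddCommGroup V] [Module (ZMod 2) V] {X : TwoValuedGroup T}
    {c c' : V → V → V} {π : V → V → T} (h : IsModel X c π) {g : V → V} (hg : g 0 = 0)
    (hv : VanishesOn (twist (c + c') g) Set.univ) :
    IsModel X c' (fun a b => π a (b + g a)) where
  surj x := by
    obtain ⟨a, b, rfl⟩ := h.surj x
    exact ⟨a, b + g a, by rw [add_assoc, ZModModule.add_self, add_zero]⟩
  one := by rw [hg, add_zero, h.one]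
  eq_iff a b a' b' := by
    rw [h.eq_iff]
    refine and_congr_right fun ha => ?_
    subst ha
    rw [add_left_inj, add_right_comm, add_left_inj]
  mul a b a' b' := by
    rw [h.mul]
    have hD := hv a trivial a' trivial (Submodule.span (ZMod 2) {a, a'})
      (Submodule.subset_span (by simp)) (Submodule.subset_span (by simp))
    obtain ⟨i, j, hij⟩ := Submodule.mem_span_pair.1 hD
    set B := b + b' + c' a a' + g (a + a') with hB
    have e : b + g a + (b' + g a') + c a a' = B + twist (c + c') g a a' := by
      simp only [twist, Pi.add_apply, hB]
      rw [← add_zero (b + g a + (b' + g a') + c a a'),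
        ← ZModModule.add_self (c' a a' + g (a + a'))]
      abel
    have e' : b + b' + c' a a' + a + g (a + a') = B + a := by rw [hB]; abel
    rw [e, e', ← hij]
    have hshift : ∀ x y : V, y = x + (a + a') → π (a + a') x = π (a + a') y :=
      fun x y hxy => (h.eq_iff _ _ _ _).2 ⟨rfl, Or.inr (by
        rw [hxy, add_assoc, ZModModule.add_self, add_zero])⟩
    rcases zmod_two_eq i with rfl | rfl <;> rcases zmod_two_eq j with rfl | rfl <;>
      simp only [zero_smul, one_smul, add_zero, zero_add]
    · rw [Multiset.pair_comm, hshift (B + a' + a) B, hshift (B + a') (B + a)]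
      · rw [← add_zero (B + a), ← ZModModule.add_self a']; abel
      · rw [add_assoc B a' a, add_assoc B, add_comm a' a, ZModModule.add_self, add_zero]
    · rw [Multiset.pair_comm, add_assoc B a a, ZModModule.add_self, add_zero]
    · rw [hshift (B + (a + a')) B, hshift (B + (a + a') + a) (B + a)]
      · rw [← add_zero (B + a), ← ZModModule.add_self (a + a')]; abel
      · rw [add_assoc, ZModModule.add_self, add_zero]

theorem IsModel.isWeakCocycle {V : Type v} [AddCommGroup V] [Module (ZMod 2) V]
    {X : TwoValuedGroup T} (hcomm : X.Commutative)
    {c : V → V → V} {π : V → V → T} (h : IsModel X c π) (hsq : ∀ x, X.e ∈ X.mul x x) :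
    IsWeakCocycle c where
  symm M a b ha hb := by
    have h1 : π (a + b) (c a b) ∈ X.mul (π b 0) (π a 0) := by
      rw [← hcomm, h.mul]; simp
    rw [h.mul] at h1
    simp only [Multiset.insert_eq_cons, Multiset.mem_cons, Multiset.mem_singleton, h.eq_iff,
      add_zero, zero_add] at h1
    have e : ∀ x y m : V, x = y + m → m ∈ M → x + y ∈ M := by
      rintro x y m rfl hm
      rwa [add_right_comm, ZModModule.add_self, zero_add]
    rcases h1 with ⟨-, h1 | h1⟩ | ⟨-, h1 | h1⟩
    · exact e _ _ 0 (by simpa using h1) M.zero_mem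
    · exact e _ _ _ h1 (M.add_mem ha hb)
    · exact e _ _ _ h1 hb
    · rw [add_assoc] at h1
      exact e _ _ _ h1 (M.add_mem hb (M.add_mem ha hb))
  self M a ha := by
    have h1 := hsq (π a 0)
    rw [h.mul, ← h.one] at h1
    simp only [Multiset.insert_eq_cons, Multiset.mem_cons, Multiset.mem_singleton, h.eq_iff,
      add_zero, zero_add] at h1
    rcases h1 with ⟨-, h1 | h1⟩ | ⟨-, h1 | h1⟩
    · exact h1 ▸ M.zero_mem
    · exact h1 ▸ M.zero_mem
    · exact mem_of_add_mem_of_mem (h1 ▸ M.zero_mem) ha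
    · exact mem_of_add_mem_of_mem (h1 ▸ M.zero_mem) ha
  zero M a ha := by
    have h1 : π a (c 0 a) ∈ X.mul (π 0 0) (π a 0) := by
      rw [h.mul]; simp
    rw [h.one, X.e_mul] at h1
    simp only [Multiset.insert_eq_cons, Multiset.mem_cons, Multiset.mem_singleton, h.eq_iff,
      zero_add] at h1
    rcases h1 with ⟨-, h1 | h1⟩ | ⟨-, h1 | h1⟩ <;> rw [h1]
    exacts [M.zero_mem, ha, M.zero_mem, ha]
  coc M a b d ha hb hd := by
    have h1 : π (a + b + d) (c a b + c (a + b) d) ∈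
        (X.mul (π a 0) (π b 0)).bind (fun t => X.mul t (π d 0)) := by
      rw [Multiset.mem_bind]
      exact ⟨π (a + b) (c a b), by rw [h.mul]; simp, by rw [h.mul]; simp⟩
    rw [X.assoc, Multiset.mem_bind] at h1
    obtain ⟨t, ht, ht'⟩ := h1
    have e : ∀ x y m : V, x = y + m → m ∈ M → x + y ∈ M := by
      rintro x y m rfl hm
      rwa [add_right_comm, ZModModule.add_self, zero_add]
    have key : ∃ m ∈ M, t = π (b + d) (c b d + m) := by
      rw [h.mul] at ht
      simp only [Multiset.insert_eq_cons, Multiset.mem_cons, Multiset.mem_singleton, add_zero,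
        zero_add] at ht
      rcases ht with rfl | rfl
      exacts [⟨0, M.zero_mem, by rw [add_zero]⟩, ⟨b, hb, rfl⟩]
    obtain ⟨m, hm, rfl⟩ := key
    rw [h.mul] at ht'
    simp only [Multiset.insert_eq_cons, Multiset.mem_cons, Multiset.mem_singleton, h.eq_iff,
      zero_add] at ht'
    have habd := M.add_mem (M.add_mem ha hb) hd
    rcases ht' with ⟨-, h1 | h1⟩ | ⟨-, h1 | h1⟩
    · exact e _ _ m (by rw [h1]; abel) hm
    · exact e _ _ (m + (a + b + d)) (by rw [h1]; abel) (M.add_mem hm habd)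
    · exact e _ _ (m + a) (by rw [h1]; abel) (M.add_mem hm ha)
    · exact e _ _ (m + a + (a + b + d)) (by rw [h1]; abel) (M.add_mem (M.add_mem hm ha) habd)

theorem IsModel.card_eq {V : Type v} [AddCommGroup V] [Module (ZMod 2) V] [Finite V]
    {X : TwoValuedGroup T} {c : V → V → V} {π : V → V → T} (h : IsModel X c π) :
    2 * Nat.card T = Nat.card V * Nat.card V + Nat.card V := by
  classical
  have : Finite T := Finite.of_surjective (fun p : V × V => π p.1 p.2) (fun x => by
    obtain ⟨a, b, h⟩ := h.surj x
    exact ⟨(a, b), h⟩)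
  have := Fintype.ofFinite V
  have := Fintype.ofFinite T
  set F : (V × V) ⊕ V → T := Sum.elim (fun p => π p.1 p.2) (fun b => π 0 b) with hF
  have hfib : ∀ x : T, (Finset.univ.filter (fun p => F p = x)).card = 2 := by
    intro x
    obtain ⟨a, b, rfl⟩ := h.surj x
    by_cases ha : a = 0
    · subst ha
      rw [Finset.card_eq_two]
      refine ⟨Sum.inl (0, b), Sum.inr b, by simp, ?_⟩
      ext (⟨a', b'⟩ | b')
      · simp only [hF, Finset.mem_filter, Finset.mem_univ, true_and, Sum.elim_inl, h.eq_iff,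
          Finset.mem_insert, Finset.mem_singleton, Sum.inl.injEq, Prod.mk.injEq, reduceCtorEq,
          or_false]
        constructor
        · rintro ⟨rfl, rfl | rfl⟩ <;> simp
        · rintro ⟨rfl, rfl⟩; simp
      · simp [hF, h.eq_iff]
    · rw [Finset.card_eq_two]
      refine ⟨Sum.inl (a, b), Sum.inl (a, b + a), by simp [ha], ?_⟩
      ext (⟨a', b'⟩ | b')
      · simp only [hF, Finset.mem_filter, Finset.mem_univ, true_and, Sum.elim_inl, h.eq_iff,
          Finset.mem_insert, Finset.mem_singleton, Sum.inl.injEq, Prod.mk.injEq]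
        constructor
        · rintro ⟨rfl, rfl | rfl⟩ <;> simp
        · rintro (⟨rfl, rfl⟩ | ⟨rfl, rfl⟩) <;> simp
      · simp only [hF, Finset.mem_filter, Finset.mem_univ, true_and, Sum.elim_inr, h.eq_iff,
          Finset.mem_insert, Finset.mem_singleton, reduceCtorEq, or_self, iff_false]
        exact fun h => ha h.1.symm
  have hcard := Finset.card_eq_sum_card_fiberwise (s := Finset.univ) (t := Finset.univ) (f := F)
    (fun _ _ => Finset.mem_univ _)
  simp only [hfib, Finset.sum_const, Finset.card_univ, Fintype.card_sum, Fintype.card_prod,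
    smul_eq_mul] at hcard
  rw [Nat.card_eq_fintype_card, Nat.card_eq_fintype_card, hcard, mul_comm]

end Model

section Coset

variable {T : Type u} {n : ℕ}

/-- The residue modulo `4` with binary digits `a` (low) and `b` (high). -/
def ofDigits (a b : ZMod 2) : ZMod 4 := (a.val + 2 * b.val : ℕ)

/-- The low binary digit of a residue modulo `4`. -/
def lowDigit (x : ZMod 4) : ZMod 2 := (x.val : ℕ)

/-- The high binary digit of a residue modulo `4`. -/
def highDigit (x : ZMod 4) : ZMod 2 := (x.val / 2 : ℕ)

theorem ofDigits_lowDigit_highDigit (x : ZMod 4) : ofDigits (lowDigit x) (highDigit x) = x := by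
  revert x; decide

theorem ofDigits_inj {a b a' b' : ZMod 2} : ofDigits a b = ofDigits a' b' ↔ a = a' ∧ b = b' := by
  revert a b a' b'; decide

theorem ofDigits_add (a b a' b' : ZMod 2) :
    ofDigits a b + ofDigits a' b' = ofDigits (a + a') (b + b' + a * a') := by
  revert a b a' b'; decide

theorem neg_ofDigits (a b : ZMod 2) : -ofDigits a b = ofDigits a (b + a) := by
  revert a b; decide

/-- The element of `C₄ⁿ` with vectors of binary digits `a` (low) and `b` (high). -/
def ofDigitsVec (a b : Fin n → ZMod 2) : C4vec n :=
  fun i => Multiplicative.ofAdd (ofDigits (a i) (b i))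

theorem ofDigitsVec_surjective (x : C4vec n) : ∃ a b, ofDigitsVec a b = x :=
  ⟨fun i => lowDigit (x i).toAdd, fun i => highDigit (x i).toAdd, funext fun i => by
    simp [ofDigitsVec, ofDigits_lowDigit_highDigit]⟩

theorem ofDigitsVec_inj {a b a' b' : Fin n → ZMod 2} :
    ofDigitsVec a b = ofDigitsVec a' b' ↔ a = a' ∧ b = b' := by
  simp only [ofDigitsVec, funext_iff, EmbeddingLike.apply_eq_iff_eq, ofDigits_inj, forall_and]

theorem ofDigitsVec_mul (a b a' b' : Fin n → ZMod 2) :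
    ofDigitsVec a b * ofDigitsVec a' b' = ofDigitsVec (a + a') (b + b' + a * a') := by
  funext i
  simp only [ofDigitsVec, Pi.mul_apply, Pi.add_apply, ← ofAdd_add, ofDigits_add]

theorem ofDigitsVec_inv (a b : Fin n → ZMod 2) :
    (ofDigitsVec a b)⁻¹ = ofDigitsVec a (b + a) := by
  funext i
  simp only [ofDigitsVec, Pi.inv_apply, Pi.add_apply, ← ofAdd_neg, neg_ofDigits]

theorem ofDigitsVec_zero : ofDigitsVec (0 : Fin n → ZMod 2) 0 = 1 := by
  funext i
  rfl

theorem vec_two_eq_zero : (2 : Fin n → ZMod 2) = 0 := funext fun _ => by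
  change (2 : ZMod 2) = 0
  decide

theorem IsAntipodalCosetOf.exists_isModel {X : TwoValuedGroup T}
    (h : IsAntipodalCosetOf X (C4vec n)) :
    ∃ π : (Fin n → ZMod 2) → (Fin n → ZMod 2) → T, IsModel X (fun a b => a * b) π := by
  obtain ⟨π, hsurj, hone, hinv, heq, hmul, -⟩ := h
  have hshift : ∀ a b, π (ofDigitsVec a (b + a)) = π (ofDigitsVec a b) := fun a b => by
    rw [← ofDigitsVec_inv, hinv]
  refine ⟨fun a b => π (ofDigitsVec a b), ⟨?_, ?_, ?_, ?_⟩⟩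
  · intro x
    obtain ⟨y, rfl⟩ := hsurj x
    obtain ⟨a, b, rfl⟩ := ofDigitsVec_surjective y
    exact ⟨a, b, rfl⟩
  · rw [ofDigitsVec_zero, hone]
  · intro a b a' b'
    constructor
    · intro h
      rcases heq _ _ h with h | h
      · rw [ofDigitsVec_inj] at h
        exact ⟨h.1.symm, Or.inl h.2.symm⟩
      · rw [ofDigitsVec_inv, ofDigitsVec_inj] at h
        refine ⟨h.1.symm, Or.inr ?_⟩
        rw [h.2, add_assoc, ZModModule.add_self, add_zero]
    · rintro ⟨rfl, rfl | rfl⟩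
      · rfl
      · exact hshift _ _
  · intro a b a' b'
    have e : b + (b' + a') + a * a' = b + b' + a * a' + a + (a + a') := by
      linear_combination -a * vec_two_eq_zero
    rw [hmul, ofDigitsVec_inv, ofDigitsVec_mul, ofDigitsVec_mul, e, hshift]

theorem IsModel.isAntipodalCosetOf {X : TwoValuedGroup T} (hX : X.Involutive)
    {π : (Fin n → ZMod 2) → (Fin n → ZMod 2) → T} (h : IsModel X (fun a b => a * b) π) :
    IsAntipodalCosetOf X (C4vec n) := by
  choose α β hαβ using ofDigitsVec_surjective (n := n)
  set p : C4vec n → T := fun x => π (α x) (β x) with hp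
  have hpd : ∀ a b, p (ofDigitsVec a b) = π a b := by
    intro a b
    have := ofDigitsVec_inj.1 (hαβ (ofDigitsVec a b))
    rw [hp]
    simp only [this.1, this.2]
  have hinv : ∀ x, p x⁻¹ = p x := by
    intro x
    obtain ⟨a, b, rfl⟩ := ofDigitsVec_surjective x
    rw [ofDigitsVec_inv, hpd, hpd, h.eq_iff]
    exact ⟨rfl, Or.inr rfl⟩
  refine ⟨p, ?_, ?_, hinv, ?_, ?_, fun x => by rw [hX, hinv]⟩
  · intro x
    obtain ⟨a, b, rfl⟩ := h.surj x
    exact ⟨_, hpd a b⟩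
  · rw [← ofDigitsVec_zero, hpd, h.one]
  · intro x y hxy
    obtain ⟨a, b, rfl⟩ := ofDigitsVec_surjective x
    obtain ⟨a', b', rfl⟩ := ofDigitsVec_surjective y
    rw [hpd, hpd, h.eq_iff] at hxy
    rw [ofDigitsVec_inv, ofDigitsVec_inj, ofDigitsVec_inj]
    obtain ⟨rfl, rfl | rfl⟩ := hxy
    · exact Or.inl ⟨rfl, rfl⟩
    · right
      rw [add_assoc, ZModModule.add_self, add_zero]
      exact ⟨rfl, rfl⟩
  · intro x y
    obtain ⟨a, b, rfl⟩ := ofDigitsVec_surjective x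
    obtain ⟨a', b', rfl⟩ := ofDigitsVec_surjective y
    rw [ofDigitsVec_inv, ofDigitsVec_mul, ofDigitsVec_mul, hpd, hpd, hpd, hpd, h.mul]
    congr 2
    rw [h.eq_iff]
    refine ⟨rfl, Or.inr ?_⟩
    linear_combination -a' * vec_two_eq_zero

/-- A vector over `𝔽₂` as an element of the multiplicative Boolean group `C₂ⁿ`. -/
def toC2vec (a : Fin n → ZMod 2) : C2vec n := fun i => Multiplicative.ofAdd (a i)

theorem toC2vec_surjective (x : C2vec n) : ∃ a, toC2vec a = x :=
  ⟨fun i => (x i).toAdd, rfl⟩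

theorem toC2vec_inj {a b : Fin n → ZMod 2} : toC2vec a = toC2vec b ↔ a = b := by
  simp only [toC2vec, funext_iff, EmbeddingLike.apply_eq_iff_eq]

theorem toC2vec_add (a b : Fin n → ZMod 2) : toC2vec (a + b) = toC2vec a * toC2vec b := rfl

theorem toC2vec_zero : toC2vec (0 : Fin n → ZMod 2) = 1 := rfl

theorem IsUnipotentCosetOf.exists_isModel {X : TwoValuedGroup T}
    (h : IsUnipotentCosetOf X (C2vec n)) :
    ∃ π : (Fin n → ZMod 2) → (Fin n → ZMod 2) → T, IsModel X 0 π := by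
  obtain ⟨π, hsurj, hone, hshift, heq, hmul, -⟩ := h
  have hshift' : ∀ a b : Fin n → ZMod 2,
      π (toC2vec a, toC2vec (b + a)) = π (toC2vec a, toC2vec b) := fun a b => by
    rw [add_comm, toC2vec_add, hshift]
  refine ⟨fun a b => π (toC2vec a, toC2vec b), ⟨?_, ?_, ?_, ?_⟩⟩
  · intro x
    obtain ⟨⟨y, z⟩, rfl⟩ := hsurj x
    obtain ⟨a, rfl⟩ := toC2vec_surjective y
    obtain ⟨b, rfl⟩ := toC2vec_surjective z
    exact ⟨a, b, rfl⟩
  · rw [toC2vec_zero, hone]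
  · intro a b a' b'
    constructor
    · intro h
      rcases heq _ _ h with h | h
      · simp only [Prod.mk.injEq, toC2vec_inj] at h
        exact ⟨h.1.symm, Or.inl h.2.symm⟩
      · simp only [← toC2vec_add, Prod.mk.injEq, toC2vec_inj] at h
        refine ⟨h.1.symm, Or.inr ?_⟩
        rw [h.2, add_right_comm, ZModModule.add_self, zero_add]
    · rintro ⟨rfl, rfl | rfl⟩
      · rfl
      · exact hshift' _ _
  · intro a b a' b'
    have e : a' + b + b' = b + b' + a + (a + a') := by
      linear_combination -a * vec_two_eq_zero
    rw [hmul, ← toC2vec_add, ← toC2vec_add, ← toC2vec_add, ← toC2vec_add, e, hshift',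
      Pi.zero_apply, Pi.zero_apply, add_zero]

theorem IsModel.isUnipotentCosetOf {X : TwoValuedGroup T} (hX : X.Involutive)
    {π : (Fin n → ZMod 2) → (Fin n → ZMod 2) → T} (h : IsModel X 0 π) :
    IsUnipotentCosetOf X (C2vec n) := by
  choose α hα using toC2vec_surjective (n := n)
  set p : C2vec n × C2vec n → T := fun x => π (α x.1) (α x.2) with hp
  have hpd : ∀ a b, p (toC2vec a, toC2vec b) = π a b := by
    intro a b
    rw [hp]
    simp only [toC2vec_inj.1 (hα (toC2vec a)), toC2vec_inj.1 (hα (toC2vec b))]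
  refine ⟨p, ?_, ?_, ?_, ?_, ?_, fun x => hX _⟩
  · intro x
    obtain ⟨a, b, rfl⟩ := h.surj x
    exact ⟨_, hpd a b⟩
  · rw [← toC2vec_zero, hpd, h.one]
  · intro x y
    obtain ⟨a, rfl⟩ := toC2vec_surjective x
    obtain ⟨b, rfl⟩ := toC2vec_surjective y
    rw [← toC2vec_add, hpd, hpd, h.eq_iff]
    exact ⟨rfl, Or.inr (add_comm _ _)⟩
  · rintro ⟨x, y⟩ ⟨x', y'⟩ hxy
    obtain ⟨a, rfl⟩ := toC2vec_surjective x
    obtain ⟨b, rfl⟩ := toC2vec_surjective y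
    obtain ⟨a', rfl⟩ := toC2vec_surjective x'
    obtain ⟨b', rfl⟩ := toC2vec_surjective y'
    rw [hpd, hpd, h.eq_iff] at hxy
    simp only [← toC2vec_add, Prod.mk.injEq, toC2vec_inj]
    obtain ⟨rfl, rfl | rfl⟩ := hxy
    · exact Or.inl ⟨rfl, rfl⟩
    · right
      rw [add_comm, add_assoc, ZModModule.add_self, add_zero]
      exact ⟨rfl, rfl⟩
  · intro x y x' y'
    obtain ⟨a, rfl⟩ := toC2vec_surjective x
    obtain ⟨b, rfl⟩ := toC2vec_surjective y
    obtain ⟨a', rfl⟩ := toC2vec_surjective x'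
    obtain ⟨b', rfl⟩ := toC2vec_surjective y'
    simp only [← toC2vec_add, hpd, h.mul, Pi.zero_apply, add_zero]
    congr 2
    rw [h.eq_iff]
    refine ⟨rfl, Or.inr ?_⟩
    linear_combination -a' * vec_two_eq_zero

theorem natCard_eq_of_isModel {X : TwoValuedGroup T}
    {c : (Fin n → ZMod 2) → (Fin n → ZMod 2) → (Fin n → ZMod 2)}
    {π : (Fin n → ZMod 2) → (Fin n → ZMod 2) → T} (h : IsModel X c π) :
    (Nat.card T : ℚ) = (2 : ℚ) ^ (2 * (n : ℤ) - 1) + (2 : ℚ) ^ ((n : ℤ) - 1) := by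
  have h1 := h.card_eq
  have h2 : Nat.card (Fin n → ZMod 2) = 2 ^ n := by simp [Nat.card_eq_fintype_card, ZMod.card]
  rw [h2] at h1
  have h3 : (2 : ℚ) * (Nat.card T : ℚ) = 2 ^ n * 2 ^ n + 2 ^ n := by exact_mod_cast h1
  rw [zpow_sub₀ two_ne_zero, zpow_sub₀ two_ne_zero, two_mul, zpow_add₀ two_ne_zero, zpow_natCast,
    zpow_one]
  linarith

theorem mem_initialVectors_two (hn : n ≤ 2) (a : Fin n → ZMod 2) : a ∈ initialVectors n 2 :=
  fun i hi => absurd i.isLt (by omega)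

theorem isomorphic_of_le_two {S : Type v} (hn : n ≤ 2) {X : TwoValuedGroup T}
    {Y : TwoValuedGroup S} {π : (Fin n → ZMod 2) → (Fin n → ZMod 2) → T}
    {π' : (Fin n → ZMod 2) → (Fin n → ZMod 2) → S}
    (h : IsModel X (fun a b => a * b) π) (h' : IsModel Y 0 π') : Isomorphic X Y := by
  refine (h.of_twist (c' := 0) (g := 0) rfl ?_).isomorphic h'
  intro a _ b _ M ha hb
  simp only [twist, Pi.add_apply, Pi.zero_apply, add_zero]
  exact mul_mem_of_mem_initialVectors_two (mem_initialVectors_two hn a)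
    (mem_initialVectors_two hn b) ha hb

end Coset

section NotIsomorphic

variable {T : Type u} {S : Type v}

theorem IsModel.map {V : Type w} [AddCommGroup V] {X : TwoValuedGroup T} {Y : TwoValuedGroup S}
    {c : V → V → V} {π : V → V → T} (h : IsModel X c π) {f : T → S} (hf : Function.Bijective f)
    (hhom : IsHom X Y f) : IsModel Y c (fun a b => f (π a b)) where
  surj y := by
    obtain ⟨x, rfl⟩ := hf.2 y
    obtain ⟨a, b, rfl⟩ := h.surj x
    exact ⟨a, b, rfl⟩
  one := by rw [h.one, hhom.1]
  eq_iff a b a' b' := by rw [hf.1.eq_iff, h.eq_iff]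
  mul a b a' b' := by
    rw [← hhom.2, h.mul, Multiset.insert_eq_cons, Multiset.map_cons, Multiset.map_singleton]
    rfl

theorem IsModel.mul_self_eq_iff {V : Type w} [AddCommGroup V] [Module (ZMod 2) V]
    {X : TwoValuedGroup T} {c : V → V → V} {π : V → V → T} (h : IsModel X c π)
    (hc : c 0 0 = 0) (a b : V) : X.mul (π a b) (π a b) = {X.e, X.e} ↔ a = 0 := by
  rw [h.mul, ZModModule.add_self, ZModModule.add_self, zero_add]
  constructor
  · intro h1
    have h2 : π 0 (c a a) ∈ ({X.e, X.e} : Multiset T) := by rw [← h1]; simp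
    have h3 : π 0 (c a a + a) ∈ ({X.e, X.e} : Multiset T) := by rw [← h1]; simp
    simp only [Multiset.insert_eq_cons, Multiset.mem_cons, Multiset.mem_singleton, or_self,
      ← h.one, h.eq_iff, add_zero, true_and] at h2 h3
    rwa [h2, zero_add] at h3
  · rintro rfl
    rw [hc, add_zero, h.one]

theorem not_isModel_zero_of_isModel_mul {n : ℕ} (hn : 3 ≤ n) {X : TwoValuedGroup T}
    {π ρ : (Fin n → ZMod 2) → (Fin n → ZMod 2) → T}
    (h : IsModel X (fun a b => a * b) π) : ¬ IsModel X 0 ρ := by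
  intro h'
  choose θ γ hθ using fun a => h.surj (ρ a 0)
  have hmem : ∀ a b x, x ∈ X.mul (ρ a 0) (ρ b 0) → ∃ i : ZMod 2,
      x = π (θ a + θ b) (γ a + γ b + θ a * θ b + i • θ a) := by
    intro a b x hx
    rw [← hθ, ← hθ, h.mul] at hx
    simp only [Multiset.insert_eq_cons, Multiset.mem_cons, Multiset.mem_singleton] at hx
    rcases hx with hx | hx
    · exact ⟨0, by rw [hx, zero_smul, add_zero]⟩
    · exact ⟨1, by rw [hx, one_smul]⟩
  have hadd : ∀ a b, ρ (a + b) 0 ∈ X.mul (ρ a 0) (ρ b 0) := by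
    intro a b
    rw [h'.mul]
    simp
  have hrel : ∀ a b, θ (a + b) = θ a + θ b ∧ ∃ i j : ZMod 2,
      γ (a + b) = γ a + γ b + θ a * θ b + i • θ a + j • (θ a + θ b) := by
    intro a b
    obtain ⟨i, hi⟩ := hmem _ _ _ (hadd a b)
    rw [← hθ, h.eq_iff] at hi
    obtain ⟨h1, h2 | h2⟩ := hi
    · exact ⟨h1, i, 0, by rw [h2, zero_smul, add_zero]⟩
    · exact ⟨h1, i, 1, by rw [h2, one_smul, h1]⟩
  have hθsurj : ∀ a', ∃ a, θ a = a' := by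
    intro a'
    obtain ⟨a, b, hab⟩ := h'.surj (π a' 0)
    refine ⟨a, ?_⟩
    obtain ⟨a₀, b₀, h0⟩ := h.surj (ρ 0 b)
    have h1 : a₀ = 0 := by
      rw [← h.mul_self_eq_iff (mul_zero 0) a₀ b₀, h0, h'.mul_self_eq_iff rfl]
    have h2 : ρ a b ∈ X.mul (ρ a 0) (ρ 0 b) := by
      rw [h'.mul]; simp
    rw [← hθ, ← h0, h.mul, hab, h1] at h2
    simp only [Multiset.insert_eq_cons, Multiset.mem_cons, Multiset.mem_singleton, h.eq_iff] at h2
    rcases h2 with h2 | h2 <;> rw [h2.1, add_zero]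
  have key : ∀ (φ : (Fin n → ZMod 2) →ₗ[ZMod 2] ZMod 2) (a b), φ (θ a) = 0 → φ (θ b) = 0 →
      φ (γ (a + b)) = φ (γ a) + φ (γ b) + φ (θ a * θ b) := by
    intro φ a b ha hb
    obtain ⟨-, i, j, hij⟩ := hrel a b
    rw [hij]
    simp [ha, hb]
  obtain ⟨u, hu⟩ := hθsurj (Pi.single ⟨0, by omega⟩ 1)
  obtain ⟨v, hv⟩ := hθsurj (Pi.single ⟨1, by omega⟩ 1)
  obtain ⟨w, hw⟩ := hθsurj (Pi.single ⟨2, by omega⟩ 1)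
  let p (k : ℕ) (hk : k < n) : (Fin n → ZMod 2) →ₗ[ZMod 2] ZMod 2 := LinearMap.proj ⟨k, hk⟩
  let p₀ := p 0 (by omega)
  let p₁ := p 1 (by omega)
  let p₂ := p 2 (by omega)
  have e1 := key p₂ u v (by simp [hu, p₂, p]) (by simp [hv, p₂, p])
  have e2 := key p₁ u w (by simp [hu, p₁, p]) (by simp [hw, p₁, p])
  have e3 := key p₀ v w (by simp [hv, p₀, p]) (by simp [hw, p₀, p])
  have two : (1 : ZMod 2) + 1 = 0 := by decide
  have e4 := key (p₁ + p₂) u (v + w) (by simp [hu, p₁, p₂, p])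
    (by simp [(hrel v w).1, hv, hw, p₁, p₂, p, two])
  have e5 := key (p₀ + p₂) v (u + w) (by simp [hv, p₀, p₂, p])
    (by simp [(hrel u w).1, hu, hw, p₀, p₂, p, two])
  have e6 := key (p₀ + p₁) w (u + v) (by simp [hw, p₀, p₁, p])
    (by simp [(hrel u v).1, hu, hv, p₀, p₁, p, two])
  have e7 := key (p₀ + p₁ + p₂) (u + v) (u + w)
    (by simp [(hrel u v).1, hu, hv, p₀, p₁, p₂, p, two])
    (by simp [(hrel u w).1, hu, hw, p₀, p₁, p₂, p, two])
  have s1 : u + v + (u + w) = v + w := by linear_combination u * vec_two_eq_zero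
  have s2 : v + (u + w) = u + (v + w) := by abel
  have s3 : w + (u + v) = u + (v + w) := by abel
  rw [s1] at e7
  rw [s2] at e5
  rw [s3] at e6
  simp only [LinearMap.add_apply, (hrel u v).1, (hrel u w).1, (hrel v w).1, hu, hv, hw] at *
  simp [p₀, p₁, p₂, p] at e1 e2 e3 e4 e5 e6 e7
  have : (1 : ZMod 2) = 0 := by
    linear_combination (norm := skip) e1 + e2 + e3 + e4 + e5 + e6 + e7
    ring_nf
    reduce_mod_char
  exact one_ne_zero this

end NotIsomorphic

section Structure

variable {T : Type u} {X : TwoValuedGroup T}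

theorem exists_mul_eq (X : TwoValuedGroup T) (x y : T) : ∃ z w, X.mul x y = {z, w} :=
  Multiset.card_eq_two.1 (X.card_mul x y)

theorem exists_mem_mul (X : TwoValuedGroup T) (x y : T) : ∃ z, z ∈ X.mul x y := by
  obtain ⟨z, w, h⟩ := X.exists_mul_eq x y
  exact ⟨z, by rw [h]; simp⟩

theorem mul_eq_pair_of_forall_mem {x y z : T} (h : ∀ w ∈ X.mul x y, w = z) :
    X.mul x y = {z, z} := by
  obtain ⟨a, b, hab⟩ := X.exists_mul_eq x y
  rw [hab] at h ⊢
  rw [h a (by simp), h b (by simp)]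

theorem mem_assoc {x y z t r : T} (ht : t ∈ X.mul x y) (hr : r ∈ X.mul t z) :
    ∃ p ∈ X.mul y z, r ∈ X.mul x p := by
  have : r ∈ (X.mul x y).bind (fun t => X.mul t z) := Multiset.mem_bind.2 ⟨t, ht, hr⟩
  rwa [X.assoc, Multiset.mem_bind] at this

theorem mem_assoc' {x y z t r : T} (ht : t ∈ X.mul y z) (hr : r ∈ X.mul x t) :
    ∃ p ∈ X.mul x y, r ∈ X.mul p z := by
  have : r ∈ (X.mul y z).bind (fun t => X.mul x t) := Multiset.mem_bind.2 ⟨t, ht, hr⟩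
  rwa [← X.assoc, Multiset.mem_bind] at this

/-- An arbitrarily chosen element of `h * x`; the multiplication by `h` if `h` is an involution. -/
noncomputable def act (X : TwoValuedGroup T) (h x : T) : T := (X.exists_mem_mul h x).choose

theorem act_mem (X : TwoValuedGroup T) (h x : T) : X.act h x ∈ X.mul h x :=
  (X.exists_mem_mul h x).choose_spec

theorem act_e (X : TwoValuedGroup T) (h : T) : X.act h X.e = h := by
  have := X.act_mem h X.e
  rw [X.mul_e] at this
  simpa using this

theorem e_act (X : TwoValuedGroup T) (x : T) : X.act X.e x = x := by
  have := X.act_mem X.e x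
  rw [X.e_mul] at this
  simpa using this

/-- `X` is a commutative involutive two-valued group in which `s x` is the square of `x`, every
element has order dividing `4`, and no pair is special. -/
structure IsOrderFour (X : TwoValuedGroup T) (s : T → T) : Prop where
  comm : X.Commutative
  eq_of_mem : ∀ {x y}, X.e ∈ X.mul x y → x = y
  mul_self : ∀ x, X.mul x x = {X.e, s x}
  mul_sq : ∀ x, X.mul x (s x) = {x, x}
  not_special : ∀ {x y}, s x ≠ X.e → s y ≠ X.e → ∀ z, X.mul x y ≠ {z, z}

theorem IsPowFamily.isOrderFour {P : T → ℤ → T} (hP : X.IsPowFamily P) (hc : X.Commutative)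
    (hinv : X.Involutive) (hns : ¬ X.IsSpecial P)
    (h124 : ∀ x : T, X.ordOf P x = 1 ∨ X.ordOf P x = 2 ∨ X.ordOf P x = 4) :
    IsOrderFour X (fun x => P x 2) := by
  have heq : ∀ {x y}, X.e ∈ X.mul x y → x = y := fun {x y} h => by
    rw [X.inv_unique x y (Or.inl h), hinv]
  have hself : ∀ x, X.mul x x = {X.e, P x 2} := by
    intro x
    obtain ⟨h0, h1, -, hm⟩ := hP x
    have := hm 1 le_rfl
    rwa [h1, sub_self, h0, one_add_one_eq_two] at this
  have hord : ∀ x k, k ≠ 0 → X.ordOf P x = k → P x k = X.e := by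
    intro x k hk h
    have hne : {n : ℕ | 0 < n ∧ P x (n : ℤ) = X.e}.Nonempty :=
      Nat.nonempty_of_pos_sInf (by rw [ordOf] at h; omega)
    have := Nat.sInf_mem hne
    rw [← h]
    exact this.2
  have hsq_e : P X.e 2 = X.e := by
    have := hself X.e
    rw [X.e_mul] at this
    simpa using this.symm
  have hcases : ∀ x, P x 2 = X.e ∨ (X.ordOf P x = 4 ∧ P x 4 = X.e) := by
    intro x
    rcases h124 x with h | h | h
    · left
      have := hord x 1 one_ne_zero h
      rw [Nat.cast_one, (hP x).2.1] at this
      rw [this, hsq_e]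
    · left
      exact_mod_cast hord x 2 two_ne_zero h
    · right
      exact ⟨h, by exact_mod_cast hord x 4 four_ne_zero h⟩
  have hgt : ∀ x, P x 2 ≠ X.e → X.OrdGT2 P x := by
    intro x hx
    rcases hcases x with h | h
    · exact absurd h hx
    · exact Or.inr (by rw [h.1]; norm_num)
  refine ⟨hc, heq, hself, ?_, fun hx hy z hz => hns ⟨_, _, z, hgt _ hx, hgt _ hy, hz⟩⟩
  intro x
  rcases hcases x with h | ⟨-, h⟩
  · rw [h, X.mul_e]
  · obtain ⟨-, h1, -, hm⟩ := hP x
    have h3 := hm 3 (by norm_num)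
    have h2 := hm 2 (by norm_num)
    norm_num at h2 h3
    rw [h] at h3
    have : x = P x 3 := heq (by rw [h3]; simp)
    rw [h2, ← this, h1]
    rfl

namespace IsOrderFour

variable {s : T → T} (hs : IsOrderFour X s)

include hs

theorem mem_rotate {x y z : T} (h : z ∈ X.mul x y) : x ∈ X.mul y z := by
  obtain ⟨p, hp, he⟩ := mem_assoc h (show X.e ∈ X.mul z z by rw [hs.mul_self]; simp)
  rwa [hs.eq_of_mem he]

theorem mem_comm {x y z : T} (h : z ∈ X.mul x y) : z ∈ X.mul y x := by
  rwa [hs.comm]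

theorem s_e : s X.e = X.e := by
  have := hs.mul_self X.e
  rw [X.e_mul] at this
  simpa using this.symm

theorem s_mem (x : T) : s x ∈ X.mul x x := by
  rw [hs.mul_self]; simp

theorem s_s (x : T) : s (s x) = X.e := by
  have h := X.assoc x x (s x)
  rw [hs.mul_self, hs.mul_sq] at h
  simp only [Multiset.insert_eq_cons, Multiset.cons_bind, Multiset.singleton_bind, X.e_mul,
    hs.mul_self] at h
  simp only [← Multiset.singleton_add] at h
  have h' : ({s x} + {s x} + {X.e} : Multiset T) + {s (s x)} =
      ({s x} + {s x} + {X.e} : Multiset T) + {X.e} := by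
    rw [add_assoc, h]
    abel
  simpa using h'

theorem act_act_self {h : T} (hh : s h = X.e) (x : T) : X.act h (X.act h x) = x := by
  obtain ⟨p, hp, hx⟩ := mem_assoc' (X.act_mem h x) (X.act_mem h (X.act h x))
  rw [hs.mul_self, hh] at hp
  obtain rfl : p = X.e := by simpa using hp
  rw [X.e_mul] at hx
  simpa using hx

theorem mul_eq_act {h : T} (hh : s h = X.e) (x : T) : X.mul h x = {X.act h x, X.act h x} := by
  have key : ∀ y r, r ∈ X.mul h y → ∀ t ∈ X.mul h r, t = y := by
    intro y r hr t ht
    obtain ⟨p, hp, hx⟩ := mem_assoc' hr ht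
    rw [hs.mul_self, hh] at hp
    obtain rfl : p = X.e := by simpa using hp
    rw [X.e_mul] at hx
    simpa using hx
  refine mul_eq_pair_of_forall_mem fun w hw => ?_
  have h1 : x ∈ X.mul h (X.act h x) := by
    obtain ⟨t, ht⟩ := X.exists_mem_mul h (X.act h x)
    exact key x _ (X.act_mem h x) t ht ▸ ht
  exact key _ x h1 w hw

theorem eq_act {h x z : T} (hh : s h = X.e) (hz : z ∈ X.mul h x) : z = X.act h x := by
  rw [hs.mul_eq_act hh] at hz
  simpa using hz

theorem act_mul {h : T} (hh : s h = X.e) (x y : T) :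
    X.mul (X.act h x) y = (X.mul x y).map (X.act h) := by
  have h1 := X.assoc h x y
  obtain ⟨z, w, hzw⟩ := X.exists_mul_eq x y
  rw [hs.mul_eq_act hh, hzw] at h1
  simp only [Multiset.insert_eq_cons, Multiset.cons_bind, Multiset.singleton_bind,
    hs.mul_eq_act hh] at h1
  rw [hzw]
  classical
  ext t
  have := congrArg (Multiset.count t) h1
  simp only [Multiset.insert_eq_cons, Multiset.map_cons, Multiset.map_singleton,
    Multiset.count_add, Multiset.count_cons, Multiset.count_singleton] at this ⊢
  omega

theorem mul_act {h : T} (hh : s h = X.e) (x y : T) :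
    X.mul x (X.act h y) = (X.mul x y).map (X.act h) := by
  rw [hs.comm, hs.act_mul hh, hs.comm]

theorem act_comm {h k : T} (hh : s h = X.e) : X.act k h = X.act h k :=
  hs.eq_act hh (hs.mem_comm (X.act_mem k h))

theorem s_act {h : T} (hh : s h = X.e) (x : T) : s (X.act h x) = s x := by
  have h1 := hs.mul_self (X.act h x)
  rw [hs.act_mul hh, hs.mul_act hh, Multiset.map_map, hs.mul_self] at h1
  simp only [Multiset.insert_eq_cons, Multiset.map_cons, Multiset.map_singleton,
    Function.comp_apply, hs.act_act_self hh] at h1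
  simpa using h1.symm

theorem act_act {h k : T} (hh : s h = X.e) (hk : s k = X.e) (x : T) :
    X.act h (X.act k x) = X.act (X.act h k) x := by
  have h1 := X.act_mem (X.act h k) x
  rw [hs.act_mul hh, hs.mul_eq_act hk] at h1
  simpa [eq_comm] using h1

theorem act_s_self (x : T) : X.act (s x) x = x := by
  have := X.act_mem (s x) x
  rw [hs.comm, hs.mul_sq] at this
  simpa using this

theorem eq_of_act_eq_self {h x : T} (hx : X.act h x = x) : h = X.e ∨ h = s x := by
  have h1 := X.act_mem h x
  rw [hx] at h1
  have := hs.mem_rotate h1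
  rw [hs.mul_self] at this
  simpa using this

theorem s_ne_of_mem_mul {x y z : T} (hz : z ∈ X.mul x y) (hy : s y ≠ X.e)
    (hz' : s z ≠ X.e) : s z ≠ s x := by
  intro h
  refine hs.not_special hz' hy x (mul_eq_pair_of_forall_mem fun w hw => ?_)
  obtain ⟨p, hp, hw⟩ := mem_assoc' (hs.mem_rotate (hs.mem_rotate hz)) hw
  rw [hs.mul_self, h] at hp
  rcases (show p = X.e ∨ p = s x by simpa using hp) with rfl | rfl
  · rw [hs.eq_act hs.s_e hw, X.e_act]
  · rw [hs.eq_act (hs.s_s x) hw, hs.act_s_self]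

theorem mul_eq_and_s_eq {x y z : T} (hz : z ∈ X.mul x y) :
    X.mul x y = {z, X.act (s x) z} ∧ s z = X.act (s x) (s y) := by
  by_cases hx : s x = X.e
  · rw [hs.mul_eq_act hx, hx, X.e_act, X.e_act, hs.eq_act hx hz, hs.s_act hx]
    exact ⟨rfl, rfl⟩
  by_cases hy : s y = X.e
  · rw [hs.eq_act hy (hs.mem_comm hz), hs.comm, hs.mul_eq_act hy, hs.act_act (hs.s_s x) hy,
      ← hs.act_comm (hs.s_s x), ← hs.act_act hy (hs.s_s x), hs.act_s_self, hs.s_act hy, hy, X.act_e]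
    exact ⟨rfl, rfl⟩
  by_cases hz' : s z = X.e
  · obtain rfl : y = X.act z x := hs.eq_act hz' (hs.mem_rotate (hs.mem_rotate hz))
    rw [hs.mul_act hz', hs.mul_self, hs.s_act hz', hz', hs.act_comm hz']
    rw [show X.act (s x) (s x) = X.e from (hs.eq_act (hs.s_s x) (by
      rw [hs.mul_self]; simp)).symm]
    simp [X.act_e]
  have hne : s z ≠ s x := hs.s_ne_of_mem_mul hz hy hz'
  have hne' : s z ≠ s y := hs.s_ne_of_mem_mul (hs.mem_comm hz) hx hz'
  constructor
  · have h1 : X.act (s x) z ∈ X.mul x y := by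
      have := hs.act_mul (hs.s_s x) x y
      rw [hs.act_s_self] at this
      rw [this]
      exact Multiset.mem_map_of_mem _ hz
    have h2 : X.act (s x) z ≠ z := fun h => (hs.eq_of_act_eq_self h).elim hx hne.symm
    obtain ⟨t, ht⟩ := Multiset.exists_cons_of_mem hz
    obtain ⟨r, hr⟩ : ∃ r, t = {r} := by
      rw [← Multiset.card_eq_one]
      have := X.card_mul x y
      rw [ht, Multiset.card_cons] at this
      omega
    rw [ht, hr] at h1 ⊢
    rcases (show X.act (s x) z = z ∨ X.act (s x) z = r by simpa using h1) with h | h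
    · exact absurd h h2
    · rw [h]; rfl
  · obtain ⟨r, hr, hsz⟩ := mem_assoc hz (hs.s_mem z)
    obtain ⟨t, ht, hrt⟩ := mem_assoc hz (hs.mem_comm hr)
    rw [hs.mul_self] at ht
    rcases (show t = X.e ∨ t = s y by simpa using ht) with rfl | rfl
    · rw [hs.eq_act hs.s_e (hs.mem_comm hrt), X.e_act, hs.mul_self] at hsz
      simp [hz', hne] at hsz
    · rw [hs.eq_act (hs.s_s y) (hs.mem_comm hrt), hs.mul_act (hs.s_s y), hs.mul_self] at hsz
      simp only [Multiset.insert_eq_cons, Multiset.map_cons, Multiset.map_singleton, X.act_e,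
        Multiset.mem_cons, Multiset.mem_singleton, hne', false_or] at hsz
      rw [hsz, hs.act_comm (hs.s_s x)]

theorem exists_eq_act {x y : T} (h : s x = s y) : ∃ k, s k = X.e ∧ y = X.act k x := by
  obtain ⟨z, hz⟩ := X.exists_mem_mul x y
  have h1 := (hs.mul_eq_and_s_eq hz).2
  have hz' : s z = X.e := by
    rw [h1, h]
    refine (hs.eq_act (hs.s_s y) ?_).symm
    rw [hs.mul_self]; simp
  exact ⟨z, hz', hs.eq_act hz' (hs.mem_rotate (hs.mem_rotate hz))⟩

end IsOrderFour

end Structure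

section DirectFactor

variable {T : Type u} {X : TwoValuedGroup T} {s : T → T}

/-- The product of two elements of a subgroup `Y`, as a multiset of elements of `Y`. -/
def subtypeMul (X : TwoValuedGroup T) {Y : Set T} (hY : X.IsSubgroup Y) (x y : Y) : Multiset Y :=
  (X.mul x y).pmap Subtype.mk (hY x x.2 y y.2)

theorem map_val_subtypeMul {Y : Set T} (hY : X.IsSubgroup Y) (x y : Y) :
    (X.subtypeMul hY x y).map Subtype.val = X.mul x y := by
  rw [subtypeMul, Multiset.map_pmap, Multiset.pmap_eq_map, Multiset.map_id']

theorem mem_subtypeMul {Y : Set T} (hY : X.IsSubgroup Y) {x y z : Y} :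
    z ∈ X.subtypeMul hY x y ↔ (z : T) ∈ X.mul x y := by
  rw [← map_val_subtypeMul hY, Multiset.mem_map_of_injective Subtype.val_injective]

/-- A subgroup of an involutive two-valued group as a two-valued group. -/
def toSubgroup (X : TwoValuedGroup T) (hX : X.Involutive) {Y : Set T} (hY : X.IsSubgroup Y)
    (he : X.e ∈ Y) : TwoValuedGroup Y where
  mul := X.subtypeMul hY
  e := ⟨X.e, he⟩
  inv y := y
  card_mul x y := by rw [← Multiset.card_map Subtype.val, map_val_subtypeMul, X.card_mul]
  assoc x y z := by
    apply Multiset.map_injective Subtype.val_injective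
    simp only [Multiset.map_bind, map_val_subtypeMul]
    rw [← Multiset.bind_map _ (fun t => X.mul t z) Subtype.val,
      ← Multiset.bind_map _ (fun t => X.mul x t) Subtype.val, map_val_subtypeMul,
      map_val_subtypeMul, X.assoc]
  e_mul x := by
    apply Multiset.map_injective Subtype.val_injective
    rw [map_val_subtypeMul, X.e_mul]
    rfl
  mul_e x := by
    apply Multiset.map_injective Subtype.val_injective
    rw [map_val_subtypeMul, X.mul_e]
    rfl
  e_mem_mul_inv x := by
    rw [mem_subtypeMul]
    simpa only [hX x.1] using X.e_mem_mul_inv x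
  e_mem_inv_mul x := by
    rw [mem_subtypeMul]
    simpa only [hX x.1] using X.e_mem_inv_mul x
  inv_unique x y h := by
    rw [mem_subtypeMul, mem_subtypeMul] at h
    have := X.inv_unique x y h
    rw [hX] at this
    exact Subtype.ext this

namespace IsOrderFour

variable (hs : IsOrderFour X s)

include hs

theorem hasSingleValuedDirectFactor (hX : X.Involutive) {Y : Set T} (hY : X.IsSubgroup Y)
    (he : X.e ∈ Y) {w : T} (hw : s w = X.e) (hwY : w ∉ Y) (hwx : ∀ x ∉ Y, X.act w x ∈ Y) :
    HasSingleValuedDirectFactor X := by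
  have hact : ∀ y ∈ Y, X.act w y ∉ Y := by
    intro y hy hwy
    exact hwY (hY _ hy _ hwy _ (hs.mem_rotate (X.act_mem w y)))
  let A (k : ULift.{u} ℤˣ) (x : T) : T := if k = 1 then x else X.act w x
  have A1 : ∀ x, A 1 x = x := fun x => if_pos rfl
  have hne : (ULift.up (-1) : ULift.{u} ℤˣ) ≠ 1 := fun h => by
    have := congrArg ULift.down h
    revert this
    decide
  have Aneg : ∀ x, A (ULift.up (-1)) x = X.act w x := fun x => if_neg hne
  have hcases : ∀ k : ULift.{u} ℤˣ, k = 1 ∨ k = ULift.up (-1) := by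
    rintro ⟨k⟩
    rcases Int.units_eq_one_or k with rfl | rfl
    exacts [Or.inl rfl, Or.inr rfl]
  have hsq : (ULift.up (-1) : ULift.{u} ℤˣ) * ULift.up (-1) = 1 := rfl
  refine ⟨Y, X.toSubgroup hX hY he, ULift.{u} ℤˣ, inferInstance, ?_, fun _ => rfl, ?_,
    ⟨⟨_, _, hne⟩⟩, fun p => A p.2 p.1, ⟨?_, ?_⟩, A1 _, ?_, fun _ _ => hX _⟩
  · intro x y
    apply Multiset.map_injective Subtype.val_injective
    exact (map_val_subtypeMul hY x y).trans ((hs.comm _ _).trans (map_val_subtypeMul hY y x).symm)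
  · intro k
    rcases hcases k with rfl | rfl
    exacts [one_mul 1, hsq]
  · rintro ⟨x, k⟩ ⟨y, l⟩ h
    rcases hcases k with rfl | rfl <;> rcases hcases l with rfl | rfl <;>
      simp only [A1, Aneg] at h
    · rw [Subtype.ext h]
    · exact absurd (h ▸ x.2) (hact _ y.2)
    · exact absurd (h ▸ y.2) (hact _ x.2)
    · rw [Subtype.ext (show (x : T) = y by
        rw [← hs.act_act_self hw x, h, hs.act_act_self hw])]
  · intro x
    by_cases hx : x ∈ Y
    · exact ⟨(⟨x, hx⟩, 1), A1 _⟩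
    · exact ⟨(⟨_, hwx x hx⟩, ULift.up (-1)), (Aneg _).trans (hs.act_act_self hw x)⟩
  · intro x y k l
    have h1 : ((X.toSubgroup hX hY he).mul x y).map (fun z : Y => A (k * l) z) =
        (X.mul x y).map (A (k * l)) := by
      rw [← map_val_subtypeMul hY x y, Multiset.map_map]
      rfl
    refine Eq.trans ?_ h1.symm
    have hid : A 1 = id := funext A1
    have hAw : A (ULift.up (-1)) = X.act w := funext Aneg
    rcases hcases k with rfl | rfl <;> rcases hcases l with rfl | rfl <;>
      simp only [hsq, mul_one, one_mul, hid, hAw, id_eq, Multiset.map_id']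
    · exact hs.mul_act hw _ _
    · exact hs.act_mul hw _ _
    · rw [hs.act_mul hw, hs.mul_act hw, Multiset.map_map]
      simp only [Function.comp_def, hs.act_act_self hw, Multiset.map_id']

theorem exists_s_eq (hX : X.Involutive) (hnf : ¬ HasSingleValuedDirectFactor X) {w : T}
    (hw : s w = X.e) : ∃ x, s x = w := by
  by_contra hne
  have hchain : ∀ c ⊆ {Y : Set T | X.IsSubgroup Y ∧ Set.range s ⊆ Y ∧ w ∉ Y},
      IsChain (· ⊆ ·) c → c.Nonempty →
      ∃ ub ∈ {Y : Set T | X.IsSubgroup Y ∧ Set.range s ⊆ Y ∧ w ∉ Y}, ∀ Y ∈ c, Y ⊆ ub := by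
    intro c hc hch ⟨Y₀, hY₀⟩
    refine ⟨⋃₀ c, ⟨?_, ?_, ?_⟩, fun Y hY => Set.subset_sUnion_of_mem hY⟩
    · rintro y₁ ⟨Y₁, hY₁, h₁⟩ y₂ ⟨Y₂, hY₂, h₂⟩ z hz
      rcases hch.total hY₁ hY₂ with h | h
      · exact ⟨Y₂, hY₂, (hc hY₂).1 _ (h h₁) _ h₂ _ hz⟩
      · exact ⟨Y₁, hY₁, (hc hY₁).1 _ h₁ _ (h h₂) _ hz⟩
    · exact (hc hY₀).2.1.trans (Set.subset_sUnion_of_mem hY₀)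
    · rintro ⟨Y, hY, hwY⟩
      exact (hc hY).2.2 hwY
  have hrange : Set.range s ∈ {Y : Set T | X.IsSubgroup Y ∧ Set.range s ⊆ Y ∧ w ∉ Y} := by
    refine ⟨?_, subset_rfl, hne⟩
    rintro _ ⟨x, rfl⟩ _ ⟨y, rfl⟩ z hz
    obtain ⟨t, ht⟩ := X.exists_mem_mul x y
    exact ⟨t, by rw [hs.eq_act (hs.s_s x) hz, (hs.mul_eq_and_s_eq ht).2]⟩
  obtain ⟨Y, -, ⟨hY, hYs, hwY⟩, hmax⟩ := zorn_subset_nonempty _ hchain _ hrange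
  have he : X.e ∈ Y := hYs ⟨X.e, hs.s_e⟩
  refine hnf (hs.hasSingleValuedDirectFactor hX hY he hw hwY fun x hx => ?_)
  have hext : X.IsSubgroup (Y ∪ {z | ∃ y ∈ Y, z ∈ X.mul y x}) := by
    have h1 : ∀ y₁ ∈ Y, ∀ z, (∃ y ∈ Y, z ∈ X.mul y x) → ∀ r ∈ X.mul y₁ z,
        ∃ y ∈ Y, r ∈ X.mul y x := by
      rintro y₁ hy₁ z ⟨y, hy, hz⟩ r hr
      obtain ⟨p, hp, hr⟩ := mem_assoc' hz hr
      exact ⟨p, hY _ hy₁ _ hy _ hp, hr⟩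
    rintro z₁ (hz₁ | hz₁) z₂ (hz₂ | hz₂) r hr
    · exact Or.inl (hY _ hz₁ _ hz₂ _ hr)
    · exact Or.inr (h1 _ hz₁ _ hz₂ _ hr)
    · exact Or.inr (h1 _ hz₂ _ hz₁ _ (hs.mem_comm hr))
    · obtain ⟨y₁, hy₁, hz₁⟩ := hz₁
      obtain ⟨y₂, hy₂, hz₂⟩ := hz₂
      obtain ⟨t, ht, hr⟩ := mem_assoc hz₁ hr
      obtain ⟨p, hp, ht⟩ := mem_assoc hz₂ (hs.mem_comm ht)
      have hpY : p ∈ Y := by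
        rw [hs.mul_self] at hp
        rcases (show p = X.e ∨ p = s x by simpa using hp) with rfl | rfl
        exacts [he, hYs ⟨x, rfl⟩]
      exact Or.inl (hY _ hy₁ _ (hY _ hy₂ _ hpY _ ht) _ hr)
  have hxmem : x ∈ Y ∪ {z | ∃ y ∈ Y, z ∈ X.mul y x} :=
    Or.inr ⟨X.e, he, by rw [X.e_mul]; simp⟩
  by_cases hw' : w ∈ Y ∪ {z | ∃ y ∈ Y, z ∈ X.mul y x}
  · obtain ⟨y, hy, hwy⟩ := hw'.resolve_left hwY
    rwa [← hs.eq_act hw (hs.mem_comm (hs.mem_rotate hwy))]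
  · exact absurd (hmax ⟨hext, hYs.trans Set.subset_union_left, hw'⟩ Set.subset_union_left hxmem) hx

end IsOrderFour

end DirectFactor

section Classification

variable {T : Type u} {X : TwoValuedGroup T} {s : T → T}

theorem IsModel.congr {V : Type v} {W : Type w} [AddCommGroup V] [AddCommGroup W]
    {c : V → V → V} {π : V → V → T} (h : IsModel X c π) (φ : W ≃+ V) :
    IsModel X (fun a b => φ.symm (c (φ a) (φ b))) (fun a b => π (φ a) (φ b)) where
  surj x := by
    obtain ⟨a, b, rfl⟩ := h.surj x
    exact ⟨φ.symm a, φ.symm b, by simp⟩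
  one := by rw [map_zero, h.one]
  eq_iff a b a' b' := by
    rw [h.eq_iff, ← map_add, φ.injective.eq_iff, φ.injective.eq_iff, φ.injective.eq_iff]
  mul a b a' b' := by simp [h.mul]

namespace IsOrderFour

/-- The Boolean group of elements of `X` of order at most two. -/
@[ext]
structure Involutions (_ : IsOrderFour X s) : Type u where
  val : T
  s_val : s val = X.e

variable (hs : IsOrderFour X s)

include hs in
theorem act_self {h : T} (hh : s h = X.e) : X.act h h = X.e := by
  rw [← hs.act_act_self hh X.e, X.act_e]

noncomputable instance : Add hs.Involutions :=
  ⟨fun h k => ⟨X.act h.1 k.1, by rw [hs.s_act h.2, k.2]⟩⟩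

instance : Zero hs.Involutions := ⟨⟨X.e, hs.s_e⟩⟩

instance : Neg hs.Involutions := ⟨id⟩

noncomputable instance : AddCommGroup hs.Involutions where
  add_assoc h k l := Involutions.ext (hs.act_act h.2 k.2 l.1).symm
  zero_add h := Involutions.ext (X.e_act h.1)
  add_zero h := Involutions.ext (X.act_e h.1)
  add_comm h k := Involutions.ext (hs.act_comm k.2)
  neg_add_cancel h := Involutions.ext (hs.act_self h.2)
  nsmul := nsmulRec
  zsmul := zsmulRec

theorem act_involutions_add (h k : hs.Involutions) (x : T) :
    X.act (h + k).1 x = X.act h.1 (X.act k.1 x) := (hs.act_act h.2 k.2 x).symm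

theorem involutions_zero_val : (0 : hs.Involutions).1 = X.e := rfl

noncomputable instance : Module (ZMod 2) hs.Involutions :=
  AddCommGroup.zmodModule (n := 2) fun h => by
    rw [two_nsmul]
    exact Involutions.ext (hs.act_self h.2)

/-- The squaring map with values in the group of involutions. -/
def sq (x : T) : hs.Involutions := ⟨s x, hs.s_s x⟩

theorem sq_eq_add {x y z : T} (hz : z ∈ X.mul x y) : hs.sq z = hs.sq x + hs.sq y :=
  Involutions.ext (hs.mul_eq_and_s_eq hz).2

theorem finite_involutions (hfg : X.FinitelyGenerated) (hsurj : Function.Surjective hs.sq) :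
    Module.Finite (ZMod 2) hs.Involutions := by
  obtain ⟨G, hG, hgen⟩ := hfg
  refine ⟨Submodule.fg_def.2 ⟨hs.sq '' G, hG.image _, ?_⟩⟩
  have h1 := hgen {x | hs.sq x ∈ Submodule.span (ZMod 2) (hs.sq '' G)}
    (fun x hx y hy z hz => by
      rw [Set.mem_ofPred_eq, hs.sq_eq_add hz]
      exact Submodule.add_mem _ hx hy)
    (fun x hx => Submodule.subset_span ⟨x, hx, rfl⟩)
  rw [eq_top_iff]
  intro h _
  obtain ⟨x, rfl⟩ := hsurj h
  exact h1.ge (Set.mem_univ x)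

theorem exists_isModel (hsurj : Function.Surjective hs.sq) :
    ∃ (c : hs.Involutions → hs.Involutions → hs.Involutions)
      (π : hs.Involutions → hs.Involutions → T), IsModel X c π := by
  classical
  obtain ⟨q, hq, hq0⟩ : ∃ q : hs.Involutions → T, (∀ a, hs.sq (q a) = a) ∧ q 0 = X.e := by
    refine ⟨Function.update (Function.surjInv hsurj) 0 X.e, fun a => ?_, Function.update_self ..⟩
    by_cases ha : a = 0
    · rw [ha, Function.update_self]
      exact Involutions.ext hs.s_e
    · rw [Function.update_of_ne ha, Function.surjInv_eq hsurj]
  have hsq : ∀ a, s (q a) = a.1 := fun a => congrArg Involutions.val (hq a)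
  have hrep : ∀ x, ∃ b : hs.Involutions, x = X.act b.1 (q (hs.sq x)) := fun x => by
    obtain ⟨k, hk, h⟩ := hs.exists_eq_act (hsq (hs.sq x))
    exact ⟨⟨k, hk⟩, h⟩
  have hc : ∀ a b, ∃ c : hs.Involutions, X.act c.1 (q (a + b)) ∈ X.mul (q a) (q b) := fun a b => by
    obtain ⟨z, hz⟩ := X.exists_mem_mul (q a) (q b)
    obtain ⟨c, hc⟩ := hrep z
    rw [hs.sq_eq_add hz, hq, hq] at hc
    exact ⟨c, hc ▸ hz⟩
  choose c hc using hc
  refine ⟨c, fun a b => X.act b.1 (q a), ⟨?_, ?_, ?_, ?_⟩⟩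
  · intro x
    obtain ⟨b, hb⟩ := hrep x
    exact ⟨_, b, hb.symm⟩
  · rw [hq0, X.act_e, involutions_zero_val]
  · intro a b a' b'
    constructor
    · intro h
      have h1 : a = a' := by
        have := congrArg s h
        rw [hs.s_act b.2, hs.s_act b'.2, hsq, hsq] at this
        exact Involutions.ext this
      subst h1
      refine ⟨rfl, ?_⟩
      have h2 : X.act (b' + b).1 (q a) = q a := by
        rw [act_involutions_add, h, hs.act_act_self b'.2]
      rcases hs.eq_of_act_eq_self h2 with h3 | h3
      · left
        have : b' + b = 0 := Involutions.ext h3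
        rw [← add_zero b, ← this, add_left_comm, ZModModule.add_self, add_zero]
      · right
        have : b' + b = a := Involutions.ext (h3.trans (hsq a))
        rw [← this, ← add_assoc, ZModModule.add_self, zero_add]
    · rintro ⟨rfl, rfl | rfl⟩
      · rfl
      · have := hs.act_s_self (q a)
        rw [hsq] at this
        rw [act_involutions_add, this]
  · intro a b a' b'
    rw [hs.act_mul b.2, hs.mul_act b'.2, (hs.mul_eq_and_s_eq (hc a a')).1, hsq,
      add_right_comm (b + b'), add_assoc (b + b') a]
    simp only [act_involutions_add]
    rfl

end IsOrderFour

end Classification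

/-- **Theorem 9.1 (thm_124).** A finitely generated non-special involutive commutative
two-valued group without single-valued direct factors, all of whose elements have order
`1`, `2` or `4`, is isomorphic to `X^a_{C₄ⁿ} = C₄ⁿ/ι_a` or to
`X^u_n = (C₂ⁿ × C₂ⁿ)/ι_u` for some `n ≥ 0`. Each of these model two-valued groups has
`2^{2n-1} + 2^{n-1}` elements; for `n ≤ 2` the two models are isomorphic, and for
`n ≥ 3` they are not. -/
theorem classification_orders124 {T : Type u} (X : TwoValuedGroup T)
    (hc : X.Commutative) (hinv : X.Involutive)
    (P : T → ℤ → T) (hP : X.IsPowFamily P)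
    (hfg : X.FinitelyGenerated)
    (hns : ¬ X.IsSpecial P)
    (hnf : ¬ HasSingleValuedDirectFactor X)
    (h124 : ∀ x : T, X.ordOf P x = 1 ∨ X.ordOf P x = 2 ∨ X.ordOf P x = 4) :
    (∃ n : ℕ, IsAntipodalCosetOf X (C4vec n) ∨ IsUnipotentCosetOf X (C2vec n)) ∧
    (∀ (n : ℕ) (S : Type v) (Y : TwoValuedGroup S),
      (IsAntipodalCosetOf Y (C4vec n) ∨ IsUnipotentCosetOf Y (C2vec n)) →
      (Nat.card S : ℚ) = (2 : ℚ) ^ (2 * (n : ℤ) - 1) + (2 : ℚ) ^ ((n : ℤ) - 1)) ∧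
    (∀ (n : ℕ) (S₁ : Type v) (S₂ : Type w)
      (Y₁ : TwoValuedGroup S₁) (Y₂ : TwoValuedGroup S₂),
      IsAntipodalCosetOf Y₁ (C4vec n) → IsUnipotentCosetOf Y₂ (C2vec n) →
      ((n ≤ 2 → Isomorphic Y₁ Y₂) ∧ (3 ≤ n → ¬ Isomorphic Y₁ Y₂))) := by
  refine ⟨?_, ?_, ?_⟩
  · have hs := hP.isOrderFour hc hinv hns h124
    have hsurj : Function.Surjective hs.sq := fun h => by
      obtain ⟨x, hx⟩ := hs.exists_s_eq hinv hnf h.2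
      exact ⟨x, IsOrderFour.Involutions.ext hx⟩
    have := hs.finite_involutions hfg hsurj
    obtain ⟨c, π, h⟩ := hs.exists_isModel hsurj
    have h' := h.congr
      (Module.finBasis (ZMod 2) hs.Involutions).equivFun.symm.toAddEquiv
    refine ⟨Module.finrank (ZMod 2) hs.Involutions, ?_⟩
    have hcoc := h'.isWeakCocycle hc fun x => by rw [hs.mul_self]; simp
    rcases hcoc.trivialOn_univ with ⟨g, hg, hv⟩ | ⟨g, hg, hv⟩
    · right
      rw [← add_zero (fun a b => _)] at hv
      exact (h'.of_twist hg hv).isUnipotentCosetOf hinv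
    · left
      exact (h'.of_twist hg hv).isAntipodalCosetOf hinv
  · rintro n S Y (h | h) <;> obtain ⟨π, h⟩ := h.exists_isModel <;>
      exact natCard_eq_of_isModel h
  · intro n S₁ S₂ Y₁ Y₂ h₁ h₂
    obtain ⟨π₁, h₁⟩ := h₁.exists_isModel
    obtain ⟨π₂, h₂⟩ := h₂.exists_isModel
    exact ⟨fun hn => isomorphic_of_le_two hn h₁ h₂, fun hn ⟨f, hf, hhom⟩ =>
      not_isModel_zero_of_isModel_mul hn (h₁.map hf hhom) h₂⟩

end TwoValuedGroup
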